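/- arXiv:2207.05967 — 6 statements merged into one kernel-verified Lean document; each statement's English description precedes it below -/
import Mathlib

section
/- For every real α > −1, every real x ≥ 0, and every real t with −1 < t < 1, the series ∑_{n=0}^∞ L_n^α(x) · t^n converges absolutely and its sum equals (1−t)^{−α−1} · e^{−x·t/(1−t)}. -/
/-- The generalized Laguerre polynomial
`L_n^α(x) = ∑_{k=0}^n ((−1)^k / k!) ((α+k+1)_{n−k} / (n−k)!) x^k`. -/
noncomputable def laguerreL (α : ℝ) (n : ℕ) (x : ℝ) : ℝ :=
  ∑ k ∈ Finset.range (n + 1),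
    ((-1 : ℝ) ^ k / (Nat.factorial k)) *
      ((ascPochhammer ℝ (n - k)).eval (α + (k : ℝ) + 1) / (Nat.factorial (n - k))) * x ^ k

theorem ascPochhammer_eval_div_factorial_eq_choose (a : ℝ) (n : ℕ) :
    (ascPochhammer ℝ n).eval a / n.factorial = Ring.choose (a + n - 1) n := by
  have h := Ring.factorial_nsmul_multichoose_eq_ascPochhammer a n
  rw [Polynomial.ascPochhammer_smeval_eq_eval, nsmul_eq_mul] at h
  rw [← h, mul_div_cancel_left₀ _ (by positivity), Ring.choose]
  congr 1
  ring

/-- The binomial series `∑ (a)_m / m! t^m = (1 - t)^{-a}`. -/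
theorem hasSum_ascPochhammer_div_factorial_mul_pow (a : ℝ) {t : ℝ} (ht : |t| < 1) :
    HasSum (fun m : ℕ => (ascPochhammer ℝ m).eval a / m.factorial * t ^ m)
      ((1 - t) ^ (-a)) := by
  have h := (Real.one_div_one_sub_rpow_hasFPowerSeriesOnBall_zero a).hasSum
    (y := t) (by simpa [enorm_eq_nnnorm, ← NNReal.coe_lt_coe] using ht)
  rw [Real.rpow_neg (by linarith [(abs_lt.mp ht).2])]
  simpa [ascPochhammer_eval_div_factorial_eq_choose, mul_comm] using h

/-- The term of the double series obtained by expanding the generating function: for `p = (k, m)`, `k` is the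
degree in `x` and `k + m` the degree in `t`. -/
noncomputable def laguerreTerm (α x t : ℝ) (p : ℕ × ℕ) : ℝ :=
  (-x * t) ^ p.1 / p.1.factorial *
    ((ascPochhammer ℝ p.2).eval (α + p.1 + 1) / p.2.factorial * t ^ p.2)

theorem hasSum_laguerreTerm_fiber (α x : ℝ) {t : ℝ} (ht : |t| < 1) (k : ℕ) :
    HasSum (fun m => laguerreTerm α x t (k, m))
      ((1 - t) ^ (-α - 1) * ((-x * t / (1 - t)) ^ k / k.factorial)) := by
  have hpos : 0 < 1 - t := by linarith [(abs_lt.mp ht).2]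
  have h := (hasSum_ascPochhammer_div_factorial_mul_pow (α + k + 1) ht).mul_left
    ((-x * t) ^ k / k.factorial)
  rw [show -(α + k + 1) = (-α - 1) - k by ring, Real.rpow_sub_natCast hpos.ne'] at h
  rw [div_pow, show ∀ a b c d : ℝ, a * (b / c / d) = b / d * (a / c) by intros; ring]
  exact h

theorem hasSum_laguerreTerm_outer (α x t : ℝ) :
    HasSum (fun k : ℕ => (1 - t) ^ (-α - 1) * ((-x * t / (1 - t)) ^ k / k.factorial))
      ((1 - t) ^ (-α - 1) * Real.exp (-x * t / (1 - t))) := by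
  have h := NormedSpace.expSeries_div_hasSum_exp (-x * t / (1 - t))
  rw [← Real.exp_eq_exp_ℝ] at h
  exact h.mul_left _

theorem abs_laguerreTerm {α : ℝ} (hα : -1 < α) (x t : ℝ) (p : ℕ × ℕ) :
    |laguerreTerm α x t p| = laguerreTerm α (-|x|) |t| p := by
  have h : 0 < (ascPochhammer ℝ p.2).eval (α + p.1 + 1) :=
    ascPochhammer_pos _ _ (by have : (0 : ℝ) ≤ p.1 := by positivity
                              linarith)
  simp [laguerreTerm, abs_mul, abs_div, abs_of_pos h]

theorem summable_abs_laguerreTerm {α : ℝ} (hα : -1 < α) (x : ℝ) {t : ℝ} (ht : |t| < 1) :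
    Summable fun p => |laguerreTerm α x t p| := by
  have hfiber := hasSum_laguerreTerm_fiber α (-|x|) (t := |t|) (by rwa [abs_abs])
  rw [summable_prod_of_nonneg fun p => abs_nonneg _]
  simp only [abs_laguerreTerm hα]
  refine ⟨fun k => (hfiber k).summable, ?_⟩
  simp only [fun k => (hfiber k).tsum_eq]
  exact (hasSum_laguerreTerm_outer α (-|x|) |t|).summable

theorem sum_antidiagonal_laguerreTerm (α x t : ℝ) (n : ℕ) :
    ∑ p ∈ Finset.HasAntidiagonal.antidiagonal n, laguerreTerm α x t p = laguerreL α n x * t ^ n := by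
  rw [Finset.Nat.sum_antidiagonal_eq_sum_range_succ_mk, laguerreL, Finset.sum_mul]
  refine Finset.sum_congr rfl fun k hk => ?_
  obtain ⟨m, rfl⟩ := Nat.exists_eq_add_of_le (Finset.mem_range_succ_iff.mp hk)
  simp only [laguerreTerm, Nat.add_sub_cancel_left]
  rw [mul_pow, neg_pow x, pow_add]
  ring

/-- Generating function of the Laguerre polynomials:
`∑ L_n^α(x) t^n = (1-t)^{-α-1} e^{-xt/(1-t)}` for `-1 < t < 1`. -/
theorem laguerre_generating_function (α : ℝ) (hα : -1 < α) (x : ℝ) (hx : 0 ≤ x)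
    (t : ℝ) (ht : -1 < t) (ht' : t < 1) :
    (Summable fun n : ℕ => |laguerreL α n x * t ^ n|) ∧
    (∑' n : ℕ, laguerreL α n x * t ^ n
      = (1 - t) ^ (-α - 1) * Real.exp (-x * t / (1 - t))) := by
  have ht1 : |t| < 1 := abs_lt.mpr ⟨ht, ht'⟩
  have habs := summable_abs_laguerreTerm hα x ht1
  have hsum : HasSum (laguerreTerm α x t)
      ((1 - t) ^ (-α - 1) * Real.exp (-x * t / (1 - t))) := by
    have h := habs.of_abs.hasSum
    rwa [(h.prod_fiberwise (hasSum_laguerreTerm_fiber α x ht1)).unique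
      (hasSum_laguerreTerm_outer α x t)] at h
  have hdiag (f : ℕ × ℕ → ℝ) {s : ℝ} (h : HasSum f s) :
      HasSum (fun n => ∑ p ∈ Finset.HasAntidiagonal.antidiagonal n, f p) s :=
    ((Finset.HasAntidiagonal.sigmaAntidiagonalEquivProd.hasSum_iff (f := f)).mpr h).sigma
      fun n => Finset.hasSum (Finset.HasAntidiagonal.antidiagonal n) f
  simp only [← sum_antidiagonal_laguerreTerm]
  exact ⟨(hdiag _ habs.hasSum).summable.of_nonneg_of_le (fun _ => abs_nonneg _)
    fun n => Finset.abs_sum_le_sum_abs _ _, (hdiag _ hsum).tsum_eq⟩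
end

section
/- For every real ν > 0, every real x ≥ 0, and every complex number z, the series ∑_{m=0}^∞ ((−z/2)^m / (ν)_m) · L_m^{ν−1}(2x) converges absolutely and its sum equals e^{−z/2} · ∑_{k=0}^∞ (z·x)^k / (k! · (ν)_k), the latter series also converging absolutely. -/
theorem ascPochhammer_eval_mul_eval_add (ν : ℝ) {k m : ℕ} (h : k ≤ m) :
    (ascPochhammer ℝ k).eval ν * (ascPochhammer ℝ (m - k)).eval (ν + k) =
      (ascPochhammer ℝ m).eval ν := by
  have := congrArg (Polynomial.eval ν) (ascPochhammer_mul ℝ k (m - k))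
  simpa [Polynomial.eval_comp, Nat.add_sub_cancel' h] using this

theorem min_one_le_ascPochhammer_eval {ν : ℝ} (hν : 0 < ν) (k : ℕ) :
    min ν 1 ≤ (ascPochhammer ℝ k).eval ν := by
  induction k with
  | zero => simp
  | succ k ih =>
    rw [ascPochhammer_succ_eval]
    rcases k with _ | k
    · simp
    · refine ih.trans (le_mul_of_one_le_right (ascPochhammer_pos _ _ hν).le ?_)
      push_cast
      linarith [k.cast_nonneg (α := ℝ)]

theorem summable_norm_pow_div_factorial_mul_ascPochhammer {ν : ℝ} (hν : 0 < ν) (w : ℂ) :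
    Summable fun k : ℕ =>
      ‖w ^ k / ((Nat.factorial k : ℂ) * (((ascPochhammer ℝ k).eval ν : ℝ) : ℂ))‖ := by
  refine Summable.of_nonneg_of_le (fun _ => norm_nonneg _) (fun k => ?_)
    ((Real.summable_pow_div_factorial ‖w‖).div_const (min ν 1))
  have hmin : 0 < min ν 1 := lt_min hν one_pos
  rw [norm_div, norm_mul, norm_pow, Complex.norm_natCast, Complex.norm_real, Real.norm_eq_abs,
    abs_of_pos (ascPochhammer_pos _ _ hν), div_div]
  gcongr
  exact min_one_le_ascPochhammer_eval hν k

theorem pow_div_ascPochhammer_mul_laguerreL {ν : ℝ} (hν : 0 < ν) (x : ℝ) (z : ℂ) (m : ℕ) :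
    (-z / 2) ^ m / (((ascPochhammer ℝ m).eval ν : ℝ) : ℂ) *
        ((laguerreL (ν - 1) m (2 * x) : ℝ) : ℂ) =
      ∑ k ∈ Finset.range (m + 1),
        (z * (x : ℂ)) ^ k / ((Nat.factorial k : ℂ) * (((ascPochhammer ℝ k).eval ν : ℝ) : ℂ)) *
          ((-z / 2) ^ (m - k) / (Nat.factorial (m - k) : ℂ)) := by
  rw [laguerreL, Complex.ofReal_sum, Finset.mul_sum]
  refine Finset.sum_congr rfl fun k hk => ?_
  have hkm : k ≤ m := Finset.mem_range_succ_iff.mp hk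
  have hpos : 0 < (ascPochhammer ℝ (m - k)).eval (ν + k) := ascPochhammer_pos _ _ (by positivity)
  have hP : (((ascPochhammer ℝ k).eval ν : ℝ) : ℂ) ≠ 0 :=
    Complex.ofReal_ne_zero.mpr (ascPochhammer_pos _ _ hν).ne'
  have hQ : (((ascPochhammer ℝ (m - k)).eval (ν + k) : ℝ) : ℂ) ≠ 0 :=
    Complex.ofReal_ne_zero.mpr hpos.ne'
  have hpow : (-z / 2) ^ m = (-z / 2) ^ k * (-z / 2) ^ (m - k) := by
    rw [← pow_add, Nat.add_sub_cancel' hkm]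
  have hzx : (z * (x : ℂ)) ^ k = (-z / 2) ^ k * ((-1) ^ k * (2 * (x : ℂ)) ^ k) := by
    rw [← mul_pow, ← mul_pow]
    ring
  rw [← ascPochhammer_eval_mul_eval_add ν hkm, show ν - 1 + (k : ℝ) + 1 = ν + k by ring, hpow, hzx]
  have hkf : (Nat.factorial k : ℂ) ≠ 0 := Nat.cast_ne_zero.mpr k.factorial_ne_zero
  have hmkf : (Nat.factorial (m - k) : ℂ) ≠ 0 := Nat.cast_ne_zero.mpr (m - k).factorial_ne_zero
  push_cast
  generalize (-z / 2) ^ k = a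
  generalize (-z / 2) ^ (m - k) = b
  field_simp

/-- Rank-one expansion of the Segal–Bargmann kernel into Laguerre polynomials:
`∑_m ((-z/2)^m/(ν)_m) L_m^{ν-1}(2x) = e^{-z/2} ∑_k (zx)^k/(k!(ν)_k)`. -/
theorem segal_bargmann_kernel_laguerre_expansion (ν : ℝ) (hν : 0 < ν) (x : ℝ) (hx : 0 ≤ x)
    (z : ℂ) :
    (Summable fun m : ℕ =>
      ‖(-z / 2) ^ m / (((ascPochhammer ℝ m).eval ν : ℝ) : ℂ) *
        ((laguerreL (ν - 1) m (2 * x) : ℝ) : ℂ)‖) ∧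
    (Summable fun k : ℕ =>
      ‖(z * (x : ℂ)) ^ k / ((Nat.factorial k : ℂ) * (((ascPochhammer ℝ k).eval ν : ℝ) : ℂ))‖) ∧
    (∑' m : ℕ, (-z / 2) ^ m / (((ascPochhammer ℝ m).eval ν : ℝ) : ℂ) *
        ((laguerreL (ν - 1) m (2 * x) : ℝ) : ℂ)
      = Complex.exp (-z / 2) *
        ∑' k : ℕ, (z * (x : ℂ)) ^ k /
          ((Nat.factorial k : ℂ) * (((ascPochhammer ℝ k).eval ν : ℝ) : ℂ))) := by
  have hA := summable_norm_pow_div_factorial_mul_ascPochhammer hν (z * (x : ℂ))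
  have hB : Summable fun n : ℕ => ‖(-z / 2) ^ n / (Nat.factorial n : ℂ)‖ :=
    (NormedSpace.norm_expSeries_div_summable (-z / 2) :)
  have hterm := funext (pow_div_ascPochhammer_mul_laguerreL hν x z)
  have hsum := tsum_mul_tsum_eq_tsum_sum_range_of_summable_norm hA hB
  have hexp : Complex.exp (-z / 2) = ∑' n : ℕ, (-z / 2) ^ n / (Nat.factorial n : ℂ) := by
    rw [Complex.exp_eq_exp_ℂ, NormedSpace.exp_eq_tsum_div]
  refine ⟨?_, hA, ?_⟩
  · exact (summable_norm_sum_mul_range_of_summable_norm hA hB).congr fun m => by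
      rw [← pow_div_ascPochhammer_mul_laguerreL hν x z m]
  · rw [hterm, ← hsum, hexp, mul_comm]
end

section
/- Let ν > 0 be real and t > 0. For every smooth function φ: ℝ → ℂ with compact support contained in (0, ∞), the series ∑_{m=0}^∞ (m!/(ν)_m) · e^{−t} L_m^{ν−1}(2t) · (2/Γ(ν)) ∫_0^∞ φ(u) · e^{−u} L_m^{ν−1}(2u) · (2u)^{ν−1} du converges absolutely and its sum equals φ(t). -/
open MeasureTheory

/-- The weight `y^α e^{-y}` for which the Laguerre polynomials of parameter `α` are orthogonal. -/
noncomputable def laguerreWeight (α y : ℝ) : ℝ := y ^ α * Real.exp (-y)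

theorem laguerreL_zero (α x : ℝ) : laguerreL α 0 x = 1 := by
  simp [laguerreL]

theorem hasDerivAt_laguerreL_succ (α : ℝ) (n : ℕ) (x : ℝ) :
    HasDerivAt (laguerreL α (n + 1)) (-laguerreL (α + 1) n x) x := by
  have h : HasDerivAt (fun y : ℝ => ∑ k ∈ Finset.range (n + 1 + 1),
      ((-1 : ℝ) ^ k / (Nat.factorial k)) *
        ((ascPochhammer ℝ (n + 1 - k)).eval (α + (k : ℝ) + 1) / (Nat.factorial (n + 1 - k))) *
          y ^ k)
      (∑ k ∈ Finset.range (n + 1 + 1), ((-1 : ℝ) ^ k / (Nat.factorial k)) *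
        ((ascPochhammer ℝ (n + 1 - k)).eval (α + (k : ℝ) + 1) / (Nat.factorial (n + 1 - k))) *
          (k * x ^ (k - 1))) x :=
    HasDerivAt.fun_sum fun k _ => (hasDerivAt_pow k x).const_mul _
  refine h.congr_deriv ?_
  rw [Finset.sum_range_succ', laguerreL, ← Finset.sum_neg_distrib]
  simp only [Nat.cast_zero, zero_mul, mul_zero, add_zero]
  refine Finset.sum_congr rfl fun k _ => ?_
  rw [show n + 1 - (k + 1) = n - k by omega, Nat.factorial_succ, add_tsub_cancel_right,
    show α + ((k + 1 : ℕ) : ℝ) + 1 = α + 1 + k + 1 by push_cast; ring, pow_succ]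
  have := Nat.cast_add_one_ne_zero (R := ℝ) k
  have := Nat.cast_ne_zero (R := ℝ).2 (Nat.factorial_ne_zero k)
  push_cast
  field_simp

theorem ascPochhammer_eval_succ_left (a : ℝ) (j : ℕ) :
    (ascPochhammer ℝ (j + 1)).eval a = a * (ascPochhammer ℝ j).eval (a + 1) := by
  rw [ascPochhammer_succ_left]
  simp [Polynomial.eval_comp]

theorem laguerreL_succ_eq_sub (α : ℝ) (n : ℕ) (x : ℝ) :
    laguerreL α (n + 1) x = laguerreL (α + 1) (n + 1) x - laguerreL (α + 1) n x := by
  simp only [laguerreL]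
  rw [Finset.sum_range_succ, Finset.sum_range_succ _ (n + 1), eq_sub_iff_add_eq, add_right_comm,
    ← Finset.sum_add_distrib]
  congr 1
  · refine Finset.sum_congr rfl fun k hk => ?_
    obtain ⟨j, rfl⟩ := Nat.exists_eq_add_of_le (Nat.lt_succ_iff.1 (Finset.mem_range.1 hk))
    rw [show k + j + 1 - k = j + 1 by omega, show k + j - k = j by omega,
      ascPochhammer_eval_succ_left, ascPochhammer_succ_eval, Nat.factorial_succ,
      show α + 1 + (k : ℝ) + 1 = α + k + 1 + 1 by ring]
    have := Nat.cast_add_one_ne_zero (R := ℝ) j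
    have := Nat.cast_ne_zero (R := ℝ).2 (Nat.factorial_ne_zero k)
    have := Nat.cast_ne_zero (R := ℝ).2 (Nat.factorial_ne_zero j)
    push_cast
    field_simp
    ring
  · simp

theorem succ_mul_laguerreL_succ (α : ℝ) (n : ℕ) (x : ℝ) :
    (n + 1) * laguerreL α (n + 1) x =
      (n + 1 + α) * laguerreL α n x - x * laguerreL (α + 1) n x := by
  have key : ∀ k ∈ Finset.range (n + 1), ((n : ℝ) + 1 - k) * (((-1 : ℝ) ^ k / (Nat.factorial k)) *
        ((ascPochhammer ℝ (n + 1 - k)).eval (α + (k : ℝ) + 1) / (Nat.factorial (n + 1 - k))) *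
          x ^ k) = (n + 1 + α) * (((-1 : ℝ) ^ k / (Nat.factorial k)) *
        ((ascPochhammer ℝ (n - k)).eval (α + (k : ℝ) + 1) / (Nat.factorial (n - k))) *
          x ^ k) := by
    intro k hk
    obtain ⟨j, rfl⟩ := Nat.exists_eq_add_of_le (Nat.lt_succ_iff.1 (Finset.mem_range.1 hk))
    rw [show k + j + 1 - k = j + 1 by omega, show k + j - k = j by omega,
      ascPochhammer_succ_eval, Nat.factorial_succ]
    have := Nat.cast_add_one_ne_zero (R := ℝ) j
    have := Nat.cast_ne_zero (R := ℝ).2 (Nat.factorial_ne_zero k)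
    have := Nat.cast_ne_zero (R := ℝ).2 (Nat.factorial_ne_zero j)
    push_cast
    field_simp
    ring
  have hx : x * (-laguerreL (α + 1) n x) = ∑ k ∈ Finset.range (n + 1 + 1),
      (k : ℝ) * (((-1 : ℝ) ^ k / (Nat.factorial k)) *
        ((ascPochhammer ℝ (n + 1 - k)).eval (α + (k : ℝ) + 1) / (Nat.factorial (n + 1 - k))) *
          x ^ k) := by
    rw [Finset.sum_range_succ', laguerreL, ← Finset.sum_neg_distrib, Finset.mul_sum]
    simp only [Nat.cast_zero, zero_mul, add_zero]
    refine Finset.sum_congr rfl fun k _ => ?_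
    rw [show n + 1 - (k + 1) = n - k by omega, Nat.factorial_succ,
      show α + ((k + 1 : ℕ) : ℝ) + 1 = α + 1 + k + 1 by push_cast; ring, pow_succ]
    have := Nat.cast_add_one_ne_zero (R := ℝ) k
    have := Nat.cast_ne_zero (R := ℝ).2 (Nat.factorial_ne_zero k)
    push_cast
    field_simp
    ring
  have hs := Finset.sum_congr rfl key
  rw [← Finset.mul_sum] at hs
  have e : (n + 1 + α) * laguerreL α n x = ∑ k ∈ Finset.range (n + 1 + 1),
      ((n : ℝ) + 1 - k) * (((-1 : ℝ) ^ k / (Nat.factorial k)) *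
        ((ascPochhammer ℝ (n + 1 - k)).eval (α + (k : ℝ) + 1) / (Nat.factorial (n + 1 - k))) *
          x ^ k) := by
    rw [laguerreL, ← hs, Finset.sum_range_succ _ (n + 1)]
    simp
  rw [sub_eq_add_neg, ← mul_neg, hx, e, ← Finset.sum_add_distrib, laguerreL, Finset.mul_sum]
  refine Finset.sum_congr rfl fun k _ => by ring

/-- The three-term recurrence. -/
theorem laguerreL_recurrence (α : ℝ) (n : ℕ) (x : ℝ) :
    (n + 2) * laguerreL α (n + 2) x =
      (2 * n + 3 + α - x) * laguerreL α (n + 1) x - (n + 1 + α) * laguerreL α n x := by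
  have h1 := succ_mul_laguerreL_succ α n x
  have h2 := succ_mul_laguerreL_succ α (n + 1) x
  have h3 := laguerreL_succ_eq_sub α n x
  push_cast at h2
  linear_combination h2 - h1 + x * h3

theorem continuous_laguerreL (α : ℝ) (n : ℕ) : Continuous (laguerreL α n) := by
  unfold laguerreL
  fun_prop

theorem hasDerivAt_laguerreWeight_add_one (α : ℝ) {y : ℝ} (hy : 0 < y) :
    HasDerivAt (laguerreWeight (α + 1)) ((α + 1 - y) * laguerreWeight α y) y := by
  have hp : y ^ (α + 1) = y ^ α * y := Real.rpow_add_one hy.ne' α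
  have h : HasDerivAt (fun y : ℝ => y ^ (α + 1) * Real.exp (-y))
      ((α + 1) * y ^ α * Real.exp (-y) + y ^ (α + 1) * (Real.exp (-y) * (-1))) y := by
    refine HasDerivAt.mul ?_ ((hasDerivAt_neg y).exp)
    simpa using Real.hasDerivAt_rpow_const (x := y) (p := α + 1) (Or.inl hy.ne')
  refine h.congr_deriv ?_
  rw [hp, laguerreWeight]
  ring

theorem laguerreWeight_add_one (α : ℝ) {y : ℝ} (hy : 0 < y) :
    laguerreWeight (α + 1) y = y * laguerreWeight α y := by
  rw [laguerreWeight, laguerreWeight, Real.rpow_add_one hy.ne']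
  ring

theorem laguerreWeight_pos (α : ℝ) {y : ℝ} (hy : 0 < y) : 0 < laguerreWeight α y := by
  unfold laguerreWeight
  positivity

theorem continuous_laguerreWeight {α : ℝ} (hα : 0 ≤ α) : Continuous (laguerreWeight α) := by
  unfold laguerreWeight
  exact (Real.continuous_rpow_const hα).mul (by fun_prop)

/-- Differential relation behind the Rodrigues formula. -/
theorem hasDerivAt_weight_mul_laguerreL (α : ℝ) (n : ℕ) {y : ℝ} (hy : 0 < y) :
    HasDerivAt (fun y : ℝ => laguerreL (α + 1) n y * laguerreWeight (α + 1) y)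
      ((n + 1) * (laguerreL α (n + 1) y * laguerreWeight α y)) y := by
  have hw := hasDerivAt_laguerreWeight_add_one α hy
  have hp := laguerreWeight_add_one α hy
  have h0 := succ_mul_laguerreL_succ α n y
  cases n with
  | zero =>
    have h : HasDerivAt (laguerreL (α + 1) 0) 0 y := by
      have : laguerreL (α + 1) 0 = fun _ => 1 := funext fun _ => laguerreL_zero _ _
      rw [this]
      exact hasDerivAt_const _ _
    refine (h.mul hw).congr_deriv ?_
    simp only [laguerreL_zero] at h0 ⊢
    rw [hp]
    push_cast at h0 ⊢
    linear_combination -laguerreWeight α y * h0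
  | succ n =>
    refine ((hasDerivAt_laguerreL_succ (α + 1) n y).mul hw).congr_deriv ?_
    have h1 := succ_mul_laguerreL_succ (α + 1) n y
    have h2 := laguerreL_succ_eq_sub α n y
    rw [hp]
    push_cast at h0 h1 ⊢
    linear_combination laguerreWeight α y * (-h0 - h1 - (n + 2 + α) * h2)

section Growth

variable {E : Type*} [NormedAddCommGroup E]

/-- Continuous functions that grow subexponentially on the positive half-line. -/
def SubexpGrowth (F : ℝ → E) : Prop :=
  Continuous F ∧ ∀ ε : ℝ, 0 < ε → ∃ C : ℝ, ∀ y : ℝ, 0 < y → ‖F y‖ ≤ C * Real.exp (ε * y)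

theorem SubexpGrowth.of_bounded {F : ℝ → E} (hF : Continuous F) {M : ℝ} (hM : ∀ y, ‖F y‖ ≤ M) :
    SubexpGrowth F := by
  refine ⟨hF, fun ε hε => ⟨M, fun y hy => (hM y).trans ?_⟩⟩
  exact le_mul_of_one_le_right ((norm_nonneg _).trans (hM y)) (Real.one_le_exp (by positivity))

theorem SubexpGrowth.add {F G : ℝ → E} (hF : SubexpGrowth F) (hG : SubexpGrowth G) :
    SubexpGrowth (fun y => F y + G y) := by
  refine ⟨hF.1.add hG.1, fun ε hε => ?_⟩
  obtain ⟨C, hC⟩ := hF.2 ε hε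
  obtain ⟨D, hD⟩ := hG.2 ε hε
  refine ⟨C + D, fun y hy => (norm_add_le _ _).trans ?_⟩
  rw [add_mul]
  exact add_le_add (hC y hy) (hD y hy)

theorem subexpGrowth_const (c : E) : SubexpGrowth (fun _ : ℝ => c) :=
  .of_bounded continuous_const fun _ => le_rfl

variable [NormedSpace ℝ E]

theorem SubexpGrowth.smul {f : ℝ → ℝ} {F : ℝ → E} (hf : SubexpGrowth f) (hF : SubexpGrowth F) :
    SubexpGrowth (fun y => f y • F y) := by
  refine ⟨hf.1.smul hF.1, fun ε hε => ?_⟩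
  obtain ⟨C, hC⟩ := hf.2 (ε / 2) (by positivity)
  obtain ⟨D, hD⟩ := hF.2 (ε / 2) (by positivity)
  refine ⟨C * D, fun y hy => ?_⟩
  rw [norm_smul]
  calc ‖f y‖ * ‖F y‖ ≤ (C * Real.exp (ε / 2 * y)) * (D * Real.exp (ε / 2 * y)) :=
        mul_le_mul (hC y hy) (hD y hy) (norm_nonneg _) ((norm_nonneg _).trans (hC y hy))
    _ = C * D * Real.exp (ε * y) := by
        rw [show ε * y = ε / 2 * y + ε / 2 * y by ring, Real.exp_add]
        ring

theorem SubexpGrowth.mul {f g : ℝ → ℝ} (hf : SubexpGrowth f) (hg : SubexpGrowth g) :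
    SubexpGrowth (fun y => f y * g y) :=
  hf.smul hg

theorem subexpGrowth_id : SubexpGrowth (fun y : ℝ => y) := by
  refine ⟨continuous_id, fun ε hε => ⟨ε⁻¹, fun y hy => ?_⟩⟩
  rw [Real.norm_of_nonneg hy.le, inv_mul_eq_div, le_div_iff₀ hε]
  linarith [Real.add_one_le_exp (ε * y)]

theorem subexpGrowth_pow (k : ℕ) : SubexpGrowth (fun y : ℝ => y ^ k) := by
  induction k with
  | zero => simpa using subexpGrowth_const (1 : ℝ)
  | succ k ih => simpa only [pow_succ] using ih.mul subexpGrowth_id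

theorem subexpGrowth_laguerreL (α : ℝ) (n : ℕ) : SubexpGrowth (laguerreL α n) := by
  unfold laguerreL
  induction n + 1 with
  | zero => simpa using subexpGrowth_const (0 : ℝ)
  | succ m ih =>
    simp only [Finset.sum_range_succ]
    exact ih.add ((subexpGrowth_const _).mul (subexpGrowth_pow m))

theorem SubexpGrowth.integrableOn {F : ℝ → E} (hF : SubexpGrowth F) {α : ℝ} (hα : -1 < α) :
    IntegrableOn (fun y => laguerreWeight α y • F y) (Set.Ioi 0) := by
  obtain ⟨C, hC⟩ := hF.2 (1 / 2) (by norm_num)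
  have hi := (integrableOn_rpow_mul_exp_neg_mul_rpow (p := 1) (b := 1 / 2) hα one_pos
    (by norm_num)).const_mul C
  refine hi.mono' ?_ ?_
  · refine ContinuousOn.aestronglyMeasurable (fun y hy => ?_) measurableSet_Ioi
    refine ContinuousAt.continuousWithinAt ?_
    have hy' : (y : ℝ) ≠ 0 := (Set.mem_Ioi.1 hy).ne'
    exact ((Real.continuousAt_rpow_const y α (Or.inl hy')).mul (by fun_prop)).smul
      hF.1.continuousAt
  · refine (ae_restrict_iff' measurableSet_Ioi).2 (Filter.Eventually.of_forall fun y hy => ?_)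
    have hy : 0 < y := hy
    rw [norm_smul, Real.norm_of_nonneg (laguerreWeight_pos α hy).le, laguerreWeight]
    calc y ^ α * Real.exp (-y) * ‖F y‖
        ≤ y ^ α * Real.exp (-y) * (C * Real.exp (1 / 2 * y)) := by gcongr; exact hC y hy
      _ = C * (y ^ α * Real.exp (-(1 / 2) * y ^ (1 : ℝ))) := by
        rw [Real.rpow_one, show -(1 / 2) * y = -y + 1 / 2 * y by ring, Real.exp_add]
        ring

theorem SubexpGrowth.integrableOn_laguerreL {F : ℝ → E} (hF : SubexpGrowth F) {α : ℝ}
    (hα : -1 < α) (n : ℕ) :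
    IntegrableOn (fun y => (laguerreL α n y * laguerreWeight α y) • F y) (Set.Ioi 0) := by
  simpa only [smul_smul, mul_comm] using ((subexpGrowth_laguerreL α n).smul hF).integrableOn hα

/-- The coefficient of `F` against the Laguerre polynomial of parameter `α` and degree `n`. -/
noncomputable def laguerreCoeff (α : ℝ) (n : ℕ) (F : ℝ → E) : E :=
  ∫ y in Set.Ioi (0 : ℝ), (laguerreL α n y * laguerreWeight α y) • F y

/-- Integration by parts against a Laguerre polynomial. -/
theorem succ_smul_laguerreCoeff [CompleteSpace E] {F F' : ℝ → E} (hF : SubexpGrowth F)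
    (hF' : SubexpGrowth F') (hd : ∀ y, HasDerivAt F (F' y) y) {α : ℝ} (hα : -1 < α) (n : ℕ) :
    ((n : ℝ) + 1) • laguerreCoeff α (n + 1) F = -laguerreCoeff (α + 1) n F' := by
  have hα' : -1 < α + 1 := by linarith
  have hi1 : IntegrableOn (fun y => ((n : ℝ) + 1) •
      ((laguerreL α (n + 1) y * laguerreWeight α y) • F y)) (Set.Ioi 0) :=
    (hF.integrableOn_laguerreL hα (n + 1)).smul ((n : ℝ) + 1)
  have hi2 := hF'.integrableOn_laguerreL hα' n
  have hd' : ∀ y ∈ Set.Ioi (0 : ℝ), HasDerivAt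
      (fun y => (laguerreL (α + 1) n y * laguerreWeight (α + 1) y) • F y)
      (((n : ℝ) + 1) • ((laguerreL α (n + 1) y * laguerreWeight α y) • F y) +
        (laguerreL (α + 1) n y * laguerreWeight (α + 1) y) • F' y) y := by
    intro y hy
    refine ((hasDerivAt_weight_mul_laguerreL α n hy).smul (hd y)).congr_deriv ?_
    rw [smul_smul, add_comm]
  have hint := integral_Ioi_of_hasDerivAt_of_tendsto (Continuous.continuousWithinAt ?_) hd'
    (hi1.add hi2)
    (tendsto_zero_of_hasDerivAt_of_integrableOn_Ioi hd' (hi1.add hi2)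
      (hF.integrableOn_laguerreL hα' n))
  · rw [integral_add hi1 hi2] at hint
    have h0 : laguerreWeight (α + 1) 0 = 0 := by
      rw [laguerreWeight, Real.zero_rpow (by linarith), zero_mul]
    rw [h0, mul_zero, zero_smul, sub_zero] at hint
    rw [laguerreCoeff, laguerreCoeff, ← integral_smul]
    exact eq_neg_of_add_eq_zero_left hint
  · exact ((continuous_laguerreL _ n).mul (continuous_laguerreWeight (by linarith))).smul hF.1

end Growth

/-- The squared norm `Γ(n+α+1)/n!` of the Laguerre polynomial of degree `n`. -/
noncomputable def laguerreNormSq (α : ℝ) (n : ℕ) : ℝ :=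
  Real.Gamma (n + α + 1) / Nat.factorial n

theorem laguerreNormSq_pos {α : ℝ} (hα : -1 < α) (n : ℕ) : 0 < laguerreNormSq α n := by
  have : (0 : ℝ) ≤ n := n.cast_nonneg
  exact div_pos (Real.Gamma_pos_of_pos (by linarith)) (by positivity)

theorem laguerreNormSq_succ {α : ℝ} (hα : -1 < α) (n : ℕ) :
    (n + 1) * laguerreNormSq α (n + 1) = (n + α + 1) * laguerreNormSq α n := by
  have : (0 : ℝ) ≤ n := n.cast_nonneg
  rw [laguerreNormSq, laguerreNormSq, Nat.factorial_succ,
    show ((n + 1 : ℕ) : ℝ) + α + 1 = n + α + 1 + 1 by push_cast; ring,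
    Real.Gamma_add_one (by linarith)]
  push_cast
  field_simp

theorem integral_laguerreWeight {α : ℝ} (hα : -1 < α) :
    ∫ y in Set.Ioi (0 : ℝ), laguerreWeight α y = Real.Gamma (α + 1) := by
  have := Real.integral_rpow_mul_exp_neg_mul_Ioi (a := α + 1) (r := 1) (by linarith) one_pos
  simpa [laguerreWeight] using this

theorem laguerreCoeff_self {α : ℝ} (hα : -1 < α) (n : ℕ) :
    laguerreCoeff α n (laguerreL α n) = laguerreNormSq α n := by
  induction n generalizing α with
  | zero =>
    simp [laguerreCoeff, laguerreL_zero, integral_laguerreWeight hα, laguerreNormSq]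
  | succ n ih =>
    have h := succ_smul_laguerreCoeff (subexpGrowth_laguerreL α (n + 1))
      (F' := fun y => (-1 : ℝ) * laguerreL (α + 1) n y)
      ((subexpGrowth_const _).mul (subexpGrowth_laguerreL (α + 1) n))
      (fun y => by simpa using hasDerivAt_laguerreL_succ α n y) hα n
    have h2 : laguerreCoeff (α + 1) n (fun y => (-1 : ℝ) * laguerreL (α + 1) n y) =
        -laguerreCoeff (α + 1) n (laguerreL (α + 1) n) := by
      simp [laguerreCoeff, integral_neg]
    rw [h2, neg_neg, ih (by linarith), smul_eq_mul] at h
    have hn : (n : ℝ) + 1 ≠ 0 := by positivity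
    rw [eq_div_of_mul_eq hn ((mul_comm _ _).trans h), laguerreNormSq, laguerreNormSq,
      Nat.factorial_succ, show ((n + 1 : ℕ) : ℝ) + α + 1 = n + (α + 1) + 1 by push_cast; ring]
    push_cast
    field_simp

theorem integrableOn_laguerreL_sq {α : ℝ} (hα : -1 < α) (n : ℕ) :
    IntegrableOn (fun y => laguerreL α n y ^ 2 * laguerreWeight α y) (Set.Ioi 0) := by
  refine ((subexpGrowth_laguerreL α n).integrableOn_laguerreL hα n).congr_fun (fun y _ => ?_)
    measurableSet_Ioi
  simp only [smul_eq_mul]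
  ring

theorem integral_laguerreL_sq {α : ℝ} (hα : -1 < α) (n : ℕ) :
    ∫ y in Set.Ioi (0 : ℝ), laguerreL α n y ^ 2 * laguerreWeight α y = laguerreNormSq α n := by
  rw [← laguerreCoeff_self hα, laguerreCoeff]
  congr 1 with y
  simp only [smul_eq_mul]
  ring

/-- Integrating the derivative of `x^{α+1} e^{-x} L(x)²` bounds it by weighted `L²` norms. -/
theorem weight_mul_sq_le {α x A B : ℝ} (hα : -1 < α) (hx : 0 < x) {P P' : ℝ → ℝ}
    (hP : ∀ y, HasDerivAt P (P' y) y)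
    (hi : IntegrableOn (fun y => P y ^ 2 * laguerreWeight α y) (Set.Ioi 0))
    (hi' : IntegrableOn (fun y => P' y ^ 2 * laguerreWeight (α + 1) y) (Set.Ioi 0))
    (hA : ∫ y in Set.Ioi (0 : ℝ), P y ^ 2 * laguerreWeight α y = A)
    (hB : ∫ y in Set.Ioi (0 : ℝ), P' y ^ 2 * laguerreWeight (α + 1) y = B) :
    P x ^ 2 * laguerreWeight (α + 1) x ≤ (α + 1) * A + B := by
  have hint : IntegrableOn ((fun y => (α + 1) * (P y ^ 2 * laguerreWeight α y)) +
      fun y => P' y ^ 2 * laguerreWeight (α + 1) y) (Set.Ioi 0) := (hi.const_mul (α + 1)).add hi'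
  have hnn : ∀ y ∈ Set.Ioi (0 : ℝ), 0 ≤ (α + 1) * (P y ^ 2 * laguerreWeight α y) +
      P' y ^ 2 * laguerreWeight (α + 1) y := fun y hy => by
    have h1 := laguerreWeight_pos α hy
    have h2 := laguerreWeight_pos (α + 1) hy
    have : 0 < α + 1 := by linarith
    positivity
  have key := intervalIntegral.sub_le_integral_of_hasDeriv_right_of_le
    (g := fun y => P y ^ 2 * laguerreWeight (α + 1) y)
    (g' := fun y => 2 * P y * P' y * laguerreWeight (α + 1) y +
      P y ^ 2 * ((α + 1 - y) * laguerreWeight α y))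
    (φ := fun y => (α + 1) * (P y ^ 2 * laguerreWeight α y) +
      P' y ^ 2 * laguerreWeight (α + 1) y) hx.le ?_ ?_ ?_ ?_
  · have h0 : laguerreWeight (α + 1) 0 = 0 := by
      rw [laguerreWeight, Real.zero_rpow (by linarith), zero_mul]
    rw [h0, mul_zero, sub_zero, intervalIntegral.integral_of_le hx.le] at key
    refine key.trans ((setIntegral_mono_set hint ?_ ?_).trans_eq ?_)
    · exact (ae_restrict_iff' measurableSet_Ioi).2 (Filter.Eventually.of_forall hnn)
    · exact Set.Ioc_subset_Ioi_self.eventuallyLE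
    · simp only [Pi.add_apply]
      rw [integral_add (hi.const_mul _) hi', integral_const_mul, hA, hB]
  · exact ((continuous_iff_continuousAt.2 fun y => (hP y).continuousAt).pow 2 |>.mul
      (continuous_laguerreWeight (by linarith))).continuousOn
  · intro y hy
    have hd := ((hP y).pow 2).mul (hasDerivAt_laguerreWeight_add_one α hy.1)
    exact (hd.congr_deriv (by simp)).hasDerivWithinAt
  · rw [integrableOn_Icc_iff_integrableOn_Ioc]
    exact hint.mono_set Set.Ioc_subset_Ioi_self
  · intro y hy
    have hw := laguerreWeight_pos (α + 1) hy.1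
    have h1 := laguerreWeight_add_one α hy.1
    have h2 : y * laguerreWeight α y * (P y ^ 2) = laguerreWeight (α + 1) y * P y ^ 2 := by rw [h1]
    nlinarith [mul_nonneg hw.le (sq_nonneg (P y - P' y))]

/-- Pointwise polynomial bound for normalized Laguerre polynomials. -/
theorem exists_abs_laguerreL_le {α x : ℝ} (hα : -1 < α) (hx : 0 < x) :
    ∃ C : ℝ, 0 ≤ C ∧ ∀ n : ℕ, |laguerreL α n x| ≤ C * (n + 1) * √(laguerreNormSq α n) := by
  have hw := laguerreWeight_pos (α + 1) hx
  have main : ∀ n : ℕ, laguerreL α n x ^ 2 * laguerreWeight (α + 1) x ≤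
      (n + α + 1) * laguerreNormSq α n := by
    intro n
    cases n with
    | zero =>
      have h := weight_mul_sq_le (P := laguerreL α 0) (P' := fun _ => 0) hα hx
        (fun y => by
          rw [show laguerreL α 0 = fun _ => 1 from funext fun _ => laguerreL_zero _ _]
          exact hasDerivAt_const _ _)
        (integrableOn_laguerreL_sq hα 0) (by simp) (integral_laguerreL_sq hα 0) rfl
      simpa using h
    | succ n =>
      have h := weight_mul_sq_le (P := laguerreL α (n + 1)) (P' := fun y => -laguerreL (α + 1) n y)
        hα hx (hasDerivAt_laguerreL_succ α n) (integrableOn_laguerreL_sq hα (n + 1))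
        (by simpa using integrableOn_laguerreL_sq (α := α + 1) (by linarith) n)
        (integral_laguerreL_sq hα (n + 1))
        (by simpa using integral_laguerreL_sq (α := α + 1) (by linarith) n)
      refine h.trans_eq ?_
      have : laguerreNormSq (α + 1) n = (n + 1) * laguerreNormSq α (n + 1) := by
        rw [laguerreNormSq, laguerreNormSq, Nat.factorial_succ,
          show ((n + 1 : ℕ) : ℝ) + α + 1 = n + (α + 1) + 1 by push_cast; ring]
        push_cast
        field_simp
      rw [this]
      push_cast
      ring
  set W := laguerreWeight (α + 1) x
  refine ⟨√((|α| + 1) / W), Real.sqrt_nonneg _, fun n => ?_⟩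
  have hQ := (laguerreNormSq_pos hα n).le
  have hn : (0 : ℝ) ≤ n := n.cast_nonneg
  rw [← Real.sqrt_sq (by positivity : (0 : ℝ) ≤ n + 1), ← Real.sqrt_mul (by positivity),
    ← Real.sqrt_mul (by positivity)]
  refine Real.abs_le_sqrt ?_
  have h1 : (n + α + 1 : ℝ) ≤ (|α| + 1) * (n + 1) ^ 2 := by
    nlinarith [le_abs_self α, abs_nonneg α, mul_nonneg (abs_nonneg α) hn,
      mul_nonneg (mul_nonneg (abs_nonneg α) hn) hn]
  calc laguerreL α n x ^ 2 = laguerreL α n x ^ 2 * W / W := by field_simp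
    _ ≤ ((|α| + 1) * (n + 1) ^ 2) * laguerreNormSq α n / W := by
      refine div_le_div_of_nonneg_right ((main n).trans ?_) hw.le
      exact mul_le_mul_of_nonneg_right h1 hQ
    _ = (|α| + 1) / W * (n + 1) ^ 2 * laguerreNormSq α n := by ring

section Decay

variable {E : Type*} [NormedAddCommGroup E] [NormedSpace ℝ E]

theorem norm_laguerreCoeff_le {α M : ℝ} (hα : -1 < α) {F : ℝ → E} (hM : ∀ y, ‖F y‖ ≤ M) (n : ℕ) :
    ‖laguerreCoeff α n F‖ ≤ (1 + Real.Gamma (α + 1)) / 2 * M * √(laguerreNormSq α n) := by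
  have hQ := laguerreNormSq_pos hα n
  set N := √(laguerreNormSq α n) with hN
  have hNpos : 0 < N := Real.sqrt_pos.2 hQ
  have hNsq : N ^ 2 = laguerreNormSq α n := Real.sq_sqrt hQ.le
  have hM0 : 0 ≤ M := (norm_nonneg _).trans (hM 0)
  have hi1 := (integrableOn_laguerreL_sq hα n).const_mul (M / (2 * N))
  have hi2 : IntegrableOn (fun y => M * N / 2 * laguerreWeight α y) (Set.Ioi 0) := by
    have := ((subexpGrowth_const (1 : ℝ)).integrableOn hα).const_mul (M * N / 2)
    simpa [IntegrableOn] using this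
  have h := norm_integral_le_of_norm_le (f := fun y =>
    (laguerreL α n y * laguerreWeight α y) • F y) (hi1.add hi2)
    ((ae_restrict_iff' measurableSet_Ioi).2 (Filter.Eventually.of_forall fun y hy => ?_))
  · refine h.trans_eq ?_
    simp only [Pi.add_apply]
    rw [integral_add hi1 hi2, integral_const_mul, integral_const_mul, integral_laguerreL_sq hα,
      integral_laguerreWeight hα, ← hNsq]
    field_simp
  · have hw := laguerreWeight_pos α hy
    have h2 : |laguerreL α n y| ≤ laguerreL α n y ^ 2 / (2 * N) + N / 2 := by
      rw [← sq_abs, div_add_div _ _ (by positivity) (by positivity), le_div_iff₀ (by positivity)]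
      nlinarith [sq_nonneg (|laguerreL α n y| - N)]
    rw [norm_smul, norm_mul, Real.norm_eq_abs, Real.norm_of_nonneg hw.le]
    calc |laguerreL α n y| * laguerreWeight α y * ‖F y‖
        ≤ (laguerreL α n y ^ 2 / (2 * N) + N / 2) * laguerreWeight α y * M := by
          gcongr
          exact hM y
      _ = _ := by
        simp only [Pi.add_apply]
        ring

variable [CompleteSpace E]

theorem iterate_laguerreCoeff {G : ℕ → ℝ → E} (hG : ∀ k, SubexpGrowth (G k))
    (hd : ∀ k y, HasDerivAt (G k) (G (k + 1) y) y) {α : ℝ} (hα : -1 < α) (n k : ℕ) :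
    ((Nat.factorial (n + k) : ℝ) / Nat.factorial n) • laguerreCoeff α (n + k) (G 0) =
      (-1 : ℝ) ^ k • laguerreCoeff (α + k) n (G k) := by
  induction k generalizing n with
  | zero => simp [div_self (Nat.cast_ne_zero (R := ℝ).2 (Nat.factorial_ne_zero n))]
  | succ k ih =>
    have hk : (0 : ℝ) ≤ k := k.cast_nonneg
    have h := succ_smul_laguerreCoeff (hG k) (hG (k + 1)) (hd k) (α := α + k) (by linarith) n
    have h2 := ih (n + 1)
    rw [show n + (k + 1) = n + 1 + k by ring,
      show ((Nat.factorial (n + 1 + k) : ℝ) / Nat.factorial n) =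
        (n + 1) * ((Nat.factorial (n + 1 + k) : ℝ) / Nat.factorial (n + 1)) by
        rw [Nat.factorial_succ n]
        push_cast
        field_simp,
      mul_smul, h2, smul_comm, h, smul_neg, pow_succ, mul_smul, neg_one_smul, smul_neg,
      show α + ((k + 1 : ℕ) : ℝ) = α + k + 1 by push_cast; ring]

/-- Rapid decay of the Laguerre coefficients of a smooth function with bounded derivatives. -/
theorem exists_norm_laguerreCoeff_le {G : ℕ → ℝ → E} {M : ℕ → ℝ} (hM : ∀ k y, ‖G k y‖ ≤ M k)
    (hd : ∀ k y, HasDerivAt (G k) (G (k + 1) y) y) {α : ℝ} (hα : -1 < α) (j : ℕ) :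
    ∃ C : ℝ, 0 ≤ C ∧ ∀ n : ℕ, ‖laguerreCoeff α (n + 2 * j) (G 0)‖ ≤
      C / (n + 1) ^ j * √(laguerreNormSq α (n + 2 * j)) := by
  have hG : ∀ k, SubexpGrowth (G k) := fun k =>
    .of_bounded (continuous_iff_continuousAt.2 fun y => (hd k y).continuousAt) (hM k)
  have hM0 : ∀ k, 0 ≤ M k := fun k => (norm_nonneg _).trans (hM k 0)
  have hα' : -1 < α + (2 * j : ℕ) := by
    have : (0 : ℝ) ≤ (2 * j : ℕ) := Nat.cast_nonneg _
    linarith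
  have hΓ : 0 < Real.Gamma (α + (2 * j : ℕ) + 1) := Real.Gamma_pos_of_pos (by linarith)
  refine ⟨(1 + Real.Gamma (α + (2 * j : ℕ) + 1)) / 2 * M (2 * j),
    mul_nonneg (by linarith) (hM0 _), fun n => ?_⟩
  set C := (1 + Real.Gamma (α + (2 * j : ℕ) + 1)) / 2 * M (2 * j)
  have hC : 0 ≤ C := mul_nonneg (by linarith) (hM0 _)
  have hb := norm_laguerreCoeff_le hα' (hM (2 * j)) n
  have h := congrArg norm (iterate_laguerreCoeff hG hd hα n (2 * j))
  set r : ℝ := (Nat.factorial (n + 2 * j) : ℝ) / Nat.factorial n with hr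
  have hrpos : 0 < r := by positivity
  have hrj : ((n : ℝ) + 1) ^ j ≤ √r := by
    refine Real.le_sqrt_of_sq_le ?_
    rw [hr, le_div_iff₀ (by positivity), ← pow_mul, mul_comm j 2, mul_comm]
    exact_mod_cast Nat.factorial_mul_pow_le_factorial
  rw [norm_smul, norm_smul, norm_pow, norm_neg, norm_one, one_pow, one_mul,
    Real.norm_of_nonneg hrpos.le] at h
  have hQ : laguerreNormSq (α + (2 * j : ℕ)) n = r * laguerreNormSq α (n + 2 * j) := by
    rw [hr, laguerreNormSq, laguerreNormSq,
      show ((n + 2 * j : ℕ) : ℝ) + α + 1 = n + (α + (2 * j : ℕ)) + 1 by push_cast; ring]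
    field_simp
  rw [hQ, Real.sqrt_mul hrpos.le, ← h] at hb
  set N := √(laguerreNormSq α (n + 2 * j))
  have hN : 0 ≤ N := Real.sqrt_nonneg _
  have hs : 0 < √r := Real.sqrt_pos.2 hrpos
  have h3 : √r * ‖laguerreCoeff α (n + 2 * j) (G 0)‖ ≤ C * N := by
    refine le_of_mul_le_mul_left ?_ hs
    rw [← mul_assoc, Real.mul_self_sqrt hrpos.le]
    exact hb.trans_eq (by ring)
  rw [div_mul_eq_mul_div, le_div_iff₀ (by positivity), mul_comm]
  exact (mul_le_mul_of_nonneg_right hrj (norm_nonneg _)).trans h3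

end Decay

section Expansion

variable {E : Type*} [NormedAddCommGroup E] [NormedSpace ℝ E]

theorem laguerreCoeff_succ_sub_smul {h : ℝ → E} (hh : SubexpGrowth h) {α : ℝ} (hα : -1 < α)
    (x : ℝ) (n : ℕ) :
    laguerreCoeff α (n + 1) (fun y => (y - x) • h y) =
      (2 * n + 3 + α - x) • laguerreCoeff α (n + 1) h - (n + 1 + α) • laguerreCoeff α n h
        - ((n : ℝ) + 2) • laguerreCoeff α (n + 2) h := by
  have h0 : IntegrableOn (fun y => ((n : ℝ) + 1 + α) •
    ((laguerreL α n y * laguerreWeight α y) • h y)) (Set.Ioi 0) :=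
    (hh.integrableOn_laguerreL hα n).smul ((n : ℝ) + 1 + α)
  have h1 : IntegrableOn (fun y => (2 * (n : ℝ) + 3 + α - x) •
    ((laguerreL α (n + 1) y * laguerreWeight α y) • h y)) (Set.Ioi 0) :=
    (hh.integrableOn_laguerreL hα (n + 1)).smul (2 * (n : ℝ) + 3 + α - x)
  have h10 : IntegrableOn (fun y => (2 * (n : ℝ) + 3 + α - x) •
      ((laguerreL α (n + 1) y * laguerreWeight α y) • h y) -
    ((n : ℝ) + 1 + α) • ((laguerreL α n y * laguerreWeight α y) • h y)) (Set.Ioi 0) := h1.sub h0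
  have h2 : IntegrableOn (fun y => ((n : ℝ) + 2) •
    ((laguerreL α (n + 2) y * laguerreWeight α y) • h y)) (Set.Ioi 0) :=
    (hh.integrableOn_laguerreL hα (n + 2)).smul ((n : ℝ) + 2)
  simp only [laguerreCoeff]
  rw [← integral_smul, ← integral_smul, ← integral_smul, ← integral_sub h1 h0,
    ← integral_sub h10 h2]
  congr 1 with y
  have hr := laguerreL_recurrence α n y
  match_scalars
  linear_combination laguerreWeight α y * hr

theorem laguerreL_one (α x : ℝ) : laguerreL α 1 x = α + 1 - x := by
  have := succ_mul_laguerreL_succ α 0 x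
  simp only [laguerreL_zero] at this
  norm_num at this
  linarith

theorem laguerreCoeff_zero_sub_smul {h : ℝ → E} (hh : SubexpGrowth h) {α : ℝ} (hα : -1 < α)
    (x : ℝ) :
    laguerreCoeff α 0 (fun y => (y - x) • h y) =
      (α + 1 - x) • laguerreCoeff α 0 h - laguerreCoeff α 1 h := by
  have h0 : IntegrableOn (fun y => (α + 1 - x) •
    ((laguerreL α 0 y * laguerreWeight α y) • h y)) (Set.Ioi 0) :=
    (hh.integrableOn_laguerreL hα 0).smul (α + 1 - x)
  simp only [laguerreCoeff]
  rw [← integral_smul, ← integral_sub h0 (hh.integrableOn_laguerreL hα 1)]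
  congr 1 with y
  simp only [laguerreL_zero, laguerreL_one]
  module

/-- The Christoffel–Darboux formula, integrated against `h`. -/
theorem sum_laguerreCoeff_sub_smul {h : ℝ → E} (hh : SubexpGrowth h) {α : ℝ} (hα : -1 < α)
    (x : ℝ) (n : ℕ) :
    ∑ m ∈ Finset.range (n + 1), (laguerreL α m x / laguerreNormSq α m) •
        laguerreCoeff α m (fun y => (y - x) • h y) =
      ((n + 1) / laguerreNormSq α n) • (laguerreL α (n + 1) x • laguerreCoeff α n h -
        laguerreL α n x • laguerreCoeff α (n + 1) h) := by
  induction n with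
  | zero =>
    simp only [zero_add, Finset.sum_range_one, laguerreCoeff_zero_sub_smul hh hα, laguerreL_zero,
      laguerreL_one]
    simp
  | succ n ih =>
    have h0 := (laguerreNormSq_pos hα n).ne'
    have h1 := (laguerreNormSq_pos hα (n + 1)).ne'
    have hQ : ((n : ℝ) + 1) / laguerreNormSq α n = (n + α + 1) / laguerreNormSq α (n + 1) := by
      rw [div_eq_div_iff h0 h1]
      exact laguerreNormSq_succ hα n
    have hr := laguerreL_recurrence α n x
    rw [Finset.sum_range_succ, ih, hQ, laguerreCoeff_succ_sub_smul hh hα]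
    match_scalars
    · field_simp
      ring
    · field_simp
      linear_combination -hr
    · field_simp
      ring

theorem laguerreCoeff_const [CompleteSpace E] {α : ℝ} (hα : -1 < α) (v : E) (n : ℕ) :
    laguerreCoeff α n (fun _ => v) = if n = 0 then laguerreNormSq α 0 • v else 0 := by
  cases n with
  | zero =>
    simp only [laguerreCoeff, laguerreL_zero, one_mul, if_true]
    rw [integral_smul_const, integral_laguerreWeight hα]
    simp [laguerreNormSq]
  | succ n =>
    have h := succ_smul_laguerreCoeff (subexpGrowth_const v) (subexpGrowth_const (0 : E))
      (fun y => hasDerivAt_const y v) hα n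
    have h2 : laguerreCoeff (α + 1) n (fun _ => (0 : E)) = 0 := by simp [laguerreCoeff]
    rw [h2, neg_zero] at h
    have hn : (n : ℝ) + 1 ≠ 0 := by positivity
    simpa [hn] using h

/-- The derivatives of the divided difference `(G 0 y - G 0 x) / (y - x)`, where `G k` is the
`k`-th derivative of `G 0`. -/
noncomputable def dividedDifference (G : ℕ → ℝ → E) (x : ℝ) (k : ℕ) (y : ℝ) : E :=
  ∫ s in (0 : ℝ)..1, s ^ k • G (k + 1) (x + s * (y - x))

theorem continuous_dividedDifference_integrand {G : ℕ → ℝ → E}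
    (hd : ∀ k y, HasDerivAt (G k) (G (k + 1) y) y) (x : ℝ) (k : ℕ) (y : ℝ) :
    Continuous (fun s : ℝ => s ^ k • G (k + 1) (x + s * (y - x))) := by
  have : Continuous (G (k + 1)) := continuous_iff_continuousAt.2 fun y => (hd _ y).continuousAt
  fun_prop

theorem norm_dividedDifference_integrand_le {G : ℕ → ℝ → E} (x : ℝ) {M : ℕ → ℝ}
    (hM : ∀ k y, ‖G k y‖ ≤ M k) (k : ℕ)
    (y : ℝ) {s : ℝ} (hs : s ∈ Set.uIoc (0 : ℝ) 1) :
    ‖s ^ k • G (k + 1) (x + s * (y - x))‖ ≤ M (k + 1) := by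
  rw [Set.uIoc_of_le zero_le_one] at hs
  rw [norm_smul, norm_pow, Real.norm_of_nonneg hs.1.le]
  exact (mul_le_of_le_one_left (norm_nonneg _) (pow_le_one₀ hs.1.le hs.2)).trans (hM _ _)

theorem norm_dividedDifference_le {G : ℕ → ℝ → E} (x : ℝ) {M : ℕ → ℝ}
    (hM : ∀ k y, ‖G k y‖ ≤ M k) (k : ℕ) (y : ℝ) :
    ‖dividedDifference G x k y‖ ≤ M (k + 1) := by
  simpa [dividedDifference] using intervalIntegral.norm_integral_le_of_norm_le_const
    fun s hs => norm_dividedDifference_integrand_le x hM k y hs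

theorem hasDerivAt_dividedDifference {G : ℕ → ℝ → E}
    (hd : ∀ k y, HasDerivAt (G k) (G (k + 1) y) y) (x : ℝ) {M : ℕ → ℝ}
    (hM : ∀ k y, ‖G k y‖ ≤ M k) (k : ℕ) (y : ℝ) :
    HasDerivAt (dividedDifference G x k) (dividedDifference G x (k + 1) y) y := by
  refine (intervalIntegral.hasDerivAt_integral_of_dominated_loc_of_deriv_le (s := Set.univ)
    (bound := fun _ => M (k + 2)) Filter.univ_mem
    (Filter.Eventually.of_forall fun z =>
      (continuous_dividedDifference_integrand hd x k z).aestronglyMeasurable)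
    ((continuous_dividedDifference_integrand hd x k y).intervalIntegrable _ _)
    (continuous_dividedDifference_integrand hd x (k + 1) y).aestronglyMeasurable
    (Filter.Eventually.of_forall fun s hs z _ =>
      norm_dividedDifference_integrand_le x hM (k + 1) z hs)
    (by simp) (Filter.Eventually.of_forall fun s _ z _ => ?_)).2
  have h1 : HasDerivAt (fun z : ℝ => x + s * (z - x)) s z := by
    simpa using (((hasDerivAt_id z).sub_const x).const_mul s).const_add x
  refine (((hd (k + 1) _).scomp z h1).const_smul (s ^ k)).congr_deriv ?_
  rw [smul_smul, pow_succ]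

theorem sub_smul_dividedDifference [CompleteSpace E] {G : ℕ → ℝ → E}
    (hd : ∀ k y, HasDerivAt (G k) (G (k + 1) y) y) (x : ℝ) (y : ℝ) :
    (y - x) • dividedDifference G x 0 y = G 0 y - G 0 x := by
  have h := intervalIntegral.integral_eq_sub_of_hasDerivAt (a := 0) (b := 1)
    (f := fun s : ℝ => G 0 (x + s * (y - x)))
    (f' := fun s : ℝ => (y - x) • G 1 (x + s * (y - x))) (fun s _ => ?_) ?_
  · rw [dividedDifference, ← intervalIntegral.integral_smul]
    simpa using h
  · have h1 : HasDerivAt (fun s : ℝ => x + s * (y - x)) (y - x) s := by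
      simpa using ((hasDerivAt_id s).mul_const (y - x)).const_add x
    exact (hd 0 _).scomp s h1
  · have hc := (continuous_dividedDifference_integrand hd x 0 y).const_smul (y - x)
    simp only [pow_zero, one_smul, zero_add] at hc
    exact hc.intervalIntegrable 0 1

variable [CompleteSpace E]

theorem sum_laguerreCoeff {G : ℕ → ℝ → E} {M : ℕ → ℝ} (hM : ∀ k y, ‖G k y‖ ≤ M k)
    (hd : ∀ k y, HasDerivAt (G k) (G (k + 1) y) y) {α : ℝ} (hα : -1 < α) (x : ℝ) (n : ℕ) :
    ∑ m ∈ Finset.range (n + 1), (laguerreL α m x / laguerreNormSq α m) •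
        laguerreCoeff α m (G 0) =
      G 0 x + ((n + 1) / laguerreNormSq α n) •
        (laguerreL α (n + 1) x • laguerreCoeff α n (dividedDifference G x 0) -
          laguerreL α n x • laguerreCoeff α (n + 1) (dividedDifference G x 0)) := by
  have hH : SubexpGrowth (dividedDifference G x 0) := .of_bounded
    (continuous_iff_continuousAt.2 fun y => (hasDerivAt_dividedDifference hd x hM 0 y).continuousAt)
    (norm_dividedDifference_le x hM 0)
  have hs : SubexpGrowth (fun y => (y - x) • dividedDifference G x 0 y) := by
    simpa only [sub_eq_add_neg] using (subexpGrowth_id.add (subexpGrowth_const (-x))).smul hH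
  have hsplit : ∀ m, laguerreCoeff α m (G 0) = laguerreCoeff α m (fun _ => G 0 x) +
      laguerreCoeff α m (fun y => (y - x) • dividedDifference G x 0 y) := by
    intro m
    rw [laguerreCoeff, laguerreCoeff, laguerreCoeff,
      ← integral_add ((subexpGrowth_const _).integrableOn_laguerreL hα m)
        (hs.integrableOn_laguerreL hα m)]
    congr 1 with y
    rw [sub_smul_dividedDifference hd, ← smul_add, add_sub_cancel]
  simp only [hsplit, smul_add]
  rw [Finset.sum_add_distrib, sum_laguerreCoeff_sub_smul hH hα]
  congr 1
  rw [Finset.sum_eq_single_of_mem 0 (by simp) fun m _ hm => by simp [laguerreCoeff_const hα, hm]]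
  rw [laguerreCoeff_const hα, if_pos rfl, laguerreL_zero, smul_smul,
    one_div_mul_cancel (laguerreNormSq_pos hα 0).ne', one_smul]

theorem sqrt_laguerreNormSq_succ_le {α : ℝ} (hα : -1 < α) (n : ℕ) :
    √(laguerreNormSq α (n + 1)) ≤ (|α| + 1) * √(laguerreNormSq α n) := by
  have hn : (0 : ℝ) ≤ n := n.cast_nonneg
  have hQ := (laguerreNormSq_pos hα n).le
  refine Real.sqrt_le_iff.2 ⟨by positivity, ?_⟩
  rw [mul_pow, Real.sq_sqrt hQ]
  refine le_of_mul_le_mul_left ?_ (by positivity : (0 : ℝ) < n + 1)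
  rw [laguerreNormSq_succ hα, ← mul_assoc]
  refine mul_le_mul_of_nonneg_right ?_ hQ
  nlinarith [le_abs_self α, abs_nonneg α, mul_nonneg (abs_nonneg α) hn,
      mul_nonneg (mul_nonneg (abs_nonneg α) hn) (abs_nonneg α), sq_nonneg α, sq_abs α]

theorem tendsto_christoffelDarboux_remainder {H : ℕ → ℝ → E} {M : ℕ → ℝ}
    (hM : ∀ k y, ‖H k y‖ ≤ M k)
    (hd : ∀ k y, HasDerivAt (H k) (H (k + 1) y) y) {α x : ℝ} (hα : -1 < α) (hx : 0 < x) :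
    Filter.Tendsto (fun n : ℕ => (((n : ℝ) + 1) / laguerreNormSq α n) •
        (laguerreL α (n + 1) x • laguerreCoeff α n (H 0) -
          laguerreL α n x • laguerreCoeff α (n + 1) (H 0))) Filter.atTop (nhds 0) := by
  obtain ⟨C, hC, hCn⟩ := exists_abs_laguerreL_le hα hx
  obtain ⟨D, hD, hDn⟩ := exists_norm_laguerreCoeff_le hM hd hα 3
  rw [← Filter.tendsto_add_atTop_iff_nat (2 * 3)]
  have hlim := (tendsto_one_div_add_atTop_nhds_zero_nat (𝕜 := ℝ)).const_mul
    (105 * C * D * (|α| + 1))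
  rw [mul_zero] at hlim
  refine squeeze_zero_norm (fun n => ?_) hlim
  set m := n + 2 * 3 with hm
  have hmn : (m : ℝ) = n + 6 := by rw [hm]; push_cast; ring
  have hn : (0 : ℝ) ≤ n := n.cast_nonneg
  have hQ := laguerreNormSq_pos hα m
  have hD1 := hDn n
  have hD2 := hDn (n + 1)
  have hC1 := hCn m
  have hC2 := hCn (m + 1)
  have hK := sqrt_laguerreNormSq_succ_le hα m
  rw [show n + 1 + 2 * 3 = m + 1 by omega] at hD2
  rw [← hm] at hD1
  rw [← Real.sq_sqrt hQ.le]
  set N := √(laguerreNormSq α m)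
  set N' := √(laguerreNormSq α (m + 1))
  have hN : 0 < N := Real.sqrt_pos.2 hQ
  have hN' : 0 ≤ N' := Real.sqrt_nonneg _
  push_cast at hC2 hD2
  rw [hmn] at hC1 hC2 ⊢
  set K := |α| + 1
  have hK0 : 0 ≤ K := by positivity
  have hD2' : ‖laguerreCoeff α (m + 1) (H 0)‖ ≤ D / (n + 1) ^ 3 * (K * N) := by
    refine hD2.trans ?_
    gcongr
    linarith
  have hC2' : |laguerreL α (m + 1) x| ≤ C * (8 * (n + 1)) * (K * N) := by
    refine hC2.trans ?_
    gcongr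
    linarith
  have hC1' : |laguerreL α m x| ≤ C * (7 * (n + 1)) * N := by
    refine hC1.trans ?_
    gcongr
    linarith
  rw [norm_smul, Real.norm_of_nonneg (by positivity)]
  calc ((n : ℝ) + 6 + 1) / N ^ 2 * ‖laguerreL α (m + 1) x • laguerreCoeff α m (H 0) -
          laguerreL α m x • laguerreCoeff α (m + 1) (H 0)‖
      ≤ (7 * (n + 1)) / N ^ 2 * (C * (8 * (n + 1)) * (K * N) * (D / (n + 1) ^ 3 * N) +
          C * (7 * (n + 1)) * N * (D / (n + 1) ^ 3 * (K * N))) := by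
        gcongr
        · linarith
        · refine (norm_sub_le _ _).trans ?_
          rw [norm_smul, norm_smul, Real.norm_eq_abs, Real.norm_eq_abs]
          gcongr
    _ = 105 * C * D * K * (1 / (n + 1)) := by
        field_simp
        ring

/-- Absolute convergence of the Laguerre series of a smooth function with bounded derivatives. -/
theorem summable_norm_laguerreCoeff {G : ℕ → ℝ → E} {M : ℕ → ℝ} (hM : ∀ k y, ‖G k y‖ ≤ M k)
    (hd : ∀ k y, HasDerivAt (G k) (G (k + 1) y) y) {α x : ℝ} (hα : -1 < α) (hx : 0 < x) :
    Summable fun m : ℕ =>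
      ‖(laguerreL α m x / laguerreNormSq α m) • laguerreCoeff α m (G 0)‖ := by
  obtain ⟨C, hC, hCn⟩ := exists_abs_laguerreL_le hα hx
  obtain ⟨D, hD, hDn⟩ := exists_norm_laguerreCoeff_le hM hd hα 3
  rw [← summable_nat_add_iff (2 * 3)]
  have hsum : Summable fun n : ℕ => 7 * C * D * (1 / ((n : ℝ) + 1) ^ 2) := by
    have := (summable_nat_add_iff 1).2 (Real.summable_one_div_nat_pow.2 one_lt_two)
    exact (by exact_mod_cast this : Summable fun n : ℕ => 1 / ((n : ℝ) + 1) ^ 2).mul_left _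
  refine hsum.of_nonneg_of_le (fun _ => norm_nonneg _) fun n => ?_
  set m := n + 2 * 3 with hm
  have hmn : (m : ℝ) = n + 6 := by rw [hm]; push_cast; ring
  have hn : (0 : ℝ) ≤ n := n.cast_nonneg
  have hQ := laguerreNormSq_pos hα m
  have hD1 := hDn n
  have hC1 := hCn m
  rw [← hm] at hD1
  rw [norm_smul, norm_div, Real.norm_eq_abs, Real.norm_of_nonneg hQ.le, ← Real.sq_sqrt hQ.le]
  set N := √(laguerreNormSq α m)
  have hN : 0 < N := Real.sqrt_pos.2 hQ
  have hC1' : |laguerreL α m x| ≤ C * (7 * (n + 1)) * N := by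
    refine hC1.trans ?_
    rw [hmn]
    gcongr
    linarith
  calc |laguerreL α m x| / N ^ 2 * ‖laguerreCoeff α m (G 0)‖
      ≤ C * (7 * (n + 1)) * N / N ^ 2 * (D / (n + 1) ^ 3 * N) := by gcongr
    _ = 7 * C * D * (1 / ((n : ℝ) + 1) ^ 2) := by
        field_simp

theorem tsum_laguerreCoeff {G : ℕ → ℝ → E} {M : ℕ → ℝ} (hM : ∀ k y, ‖G k y‖ ≤ M k)
    (hd : ∀ k y, HasDerivAt (G k) (G (k + 1) y) y) {α x : ℝ} (hα : -1 < α) (hx : 0 < x) :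
    ∑' m : ℕ, (laguerreL α m x / laguerreNormSq α m) • laguerreCoeff α m (G 0) = G 0 x := by
  have h1 := (summable_norm_laguerreCoeff hM hd hα hx).of_norm.hasSum.tendsto_sum_nat
  refine tendsto_nhds_unique ((Filter.tendsto_add_atTop_iff_nat 1).2 h1) ?_
  simp only [sum_laguerreCoeff hM hd hα x]
  simpa using (tendsto_christoffelDarboux_remainder (M := fun k => M (k + 1))
    (norm_dividedDifference_le x hM) (hasDerivAt_dividedDifference hd x hM) hα hx).const_add
      (G 0 x)

end Expansion

theorem exists_norm_iteratedDeriv_le {f : ℝ → ℂ} (hf : ContDiff ℝ (⊤ : ℕ∞) f)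
    (hc : HasCompactSupport f) (k : ℕ) : ∃ M, ∀ y, ‖iteratedDeriv k f y‖ ≤ M := by
  have h1 : Continuous (iteratedDeriv k f) :=
    hf.continuous_iteratedDeriv k (by exact_mod_cast le_top)
  have h2 : HasCompactSupport (iteratedDeriv k f) := by
    rw [iteratedDeriv_eq_equiv_comp]
    exact (hc.iteratedFDeriv k).comp_left (by simp)
  exact h2.exists_bound_of_continuous h1

theorem Gamma_mul_ascPochhammer {ν : ℝ} (hν : 0 < ν) (m : ℕ) :
    Real.Gamma ν * (ascPochhammer ℝ m).eval ν =
      laguerreNormSq (ν - 1) m * Nat.factorial m := by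
  rw [laguerreNormSq, div_mul_cancel₀ _ (by positivity)]
  induction m with
  | zero => simp
  | succ m ih =>
    have : (0 : ℝ) ≤ m := m.cast_nonneg
    rw [ascPochhammer_succ_eval, ← mul_assoc, ih,
      show ((m + 1 : ℕ) : ℝ) + (ν - 1) + 1 = m + (ν - 1) + 1 + 1 by push_cast; ring,
      Real.Gamma_add_one (s := (m : ℝ) + (ν - 1) + 1) (by linarith)]
    ring

/-- Expansion of the Dirac distribution `δ_t` into Laguerre functions: for every smooth
`φ` compactly supported in `(0,∞)`,
`∑_m (m!/(ν)_m) ℓ_m^ν(t)·(2/Γ(ν)) ∫_0^∞ φ(u) ℓ_m^ν(u) (2u)^{ν-1} du / m! ... = φ(t)`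
(rank-one case, with `ℓ_m^ν(u) = e^{-u} L_m^{ν-1}(2u)`). -/
theorem dirac_laguerre_expansion (ν t : ℝ) (hν : 0 < ν) (ht : 0 < t)
    (φ : ℝ → ℂ) (hφ : ContDiff ℝ (⊤ : ℕ∞) φ) (hcs : HasCompactSupport φ)
    (hsupp : tsupport φ ⊆ Set.Ioi 0) :
    (Summable fun m : ℕ =>
      ‖((Nat.factorial m : ℂ) / (((ascPochhammer ℝ m).eval ν : ℝ) : ℂ)) *
        ((Real.exp (-t) * laguerreL (ν - 1) m (2 * t) : ℝ) : ℂ) *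
        (((2 / Real.Gamma ν : ℝ) : ℂ) *
          ∫ u in Set.Ioi (0 : ℝ),
            φ u * ((Real.exp (-u) * laguerreL (ν - 1) m (2 * u) * (2 * u) ^ (ν - 1) : ℝ) : ℂ))‖) ∧
    (∑' m : ℕ,
      ((Nat.factorial m : ℂ) / (((ascPochhammer ℝ m).eval ν : ℝ) : ℂ)) *
        ((Real.exp (-t) * laguerreL (ν - 1) m (2 * t) : ℝ) : ℂ) *
        (((2 / Real.Gamma ν : ℝ) : ℂ) *
          ∫ u in Set.Ioi (0 : ℝ),
            φ u * ((Real.exp (-u) * laguerreL (ν - 1) m (2 * u) * (2 * u) ^ (ν - 1) : ℝ) : ℂ))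
      = φ t) := by

  set f : ℝ → ℂ := fun y => φ (2⁻¹ * y) * (Real.exp (2⁻¹ * y) : ℂ) with hfdef
  have hf : ContDiff ℝ (⊤ : ℕ∞) f := by
    refine (hφ.comp (contDiff_const.mul contDiff_id)).mul ?_
    exact Complex.ofRealCLM.contDiff.comp (Real.contDiff_exp.comp (contDiff_const.mul contDiff_id))
  have hfc : HasCompactSupport f := by
    refine HasCompactSupport.mul_right ?_
    exact hcs.comp_homeomorph (Homeomorph.mulLeft₀ (2⁻¹ : ℝ) (by norm_num))
  choose M hM using exists_norm_iteratedDeriv_le hf hfc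
  have hd : ∀ k y, HasDerivAt (iteratedDeriv k f) (iteratedDeriv (k + 1) f y) y := by
    intro k y
    rw [iteratedDeriv_succ]
    exact (hf.differentiable_iteratedDeriv k
      (by exact_mod_cast ENat.natCast_lt_top k)).differentiableAt.hasDerivAt
  have hα : -1 < ν - 1 := by linarith
  have hx : 0 < 2 * t := by positivity
  have hs := summable_norm_laguerreCoeff hM hd hα hx
  have ht := tsum_laguerreCoeff hM hd hα hx
  simp only [iteratedDeriv_zero] at hs ht
  have hterm : ∀ m : ℕ,
      ((Nat.factorial m : ℂ) / (((ascPochhammer ℝ m).eval ν : ℝ) : ℂ)) *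
        ((Real.exp (-t) * laguerreL (ν - 1) m (2 * t) : ℝ) : ℂ) *
        (((2 / Real.Gamma ν : ℝ) : ℂ) *
          ∫ u in Set.Ioi (0 : ℝ),
            φ u * ((Real.exp (-u) * laguerreL (ν - 1) m (2 * u) * (2 * u) ^ (ν - 1) : ℝ) : ℂ)) =
      (Real.exp (-t) : ℂ) * ((laguerreL (ν - 1) m (2 * t) / laguerreNormSq (ν - 1) m) •
        laguerreCoeff (ν - 1) m f) := by
    intro m
    have hint : ∫ u in Set.Ioi (0 : ℝ),
            φ u * ((Real.exp (-u) * laguerreL (ν - 1) m (2 * u) * (2 * u) ^ (ν - 1) : ℝ) : ℂ) =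
        (2⁻¹ : ℝ) • laguerreCoeff (ν - 1) m f := by
      have h := integral_comp_mul_left_Ioi
        (fun y => (laguerreL (ν - 1) m y * laguerreWeight (ν - 1) y) • f y) 0 two_pos
      rw [mul_zero] at h
      rw [laguerreCoeff, ← h]
      congr 1 with u
      have he : Real.exp (-(2 * u)) = Real.exp (-u) * Real.exp (-u) := by
        rw [← Real.exp_add]
        ring_nf
      have he' : (Real.exp (-u) : ℂ) * (Real.exp u : ℂ) = 1 := by
        rw [← Complex.ofReal_mul, ← Real.exp_add]
        simp
      simp only [hfdef, laguerreWeight, inv_mul_cancel_left₀ (two_ne_zero' ℝ), he,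
        Complex.real_smul, Complex.ofReal_mul]
      linear_combination (-φ u * (Real.exp (-u) : ℂ) * (laguerreL (ν - 1) m (2 * u) : ℂ) *
        (((2 * u) ^ (ν - 1) : ℝ) : ℂ)) * he'
    have hQ := Gamma_mul_ascPochhammer hν m
    have hΓ := (Real.Gamma_pos_of_pos hν).ne'
    have hN := (laguerreNormSq_pos hα m).ne'
    have hp := (ascPochhammer_pos m ν hν).ne'
    have hc : (Nat.factorial m : ℝ) / (ascPochhammer ℝ m).eval ν *
        (Real.exp (-t) * laguerreL (ν - 1) m (2 * t)) * (2 / Real.Gamma ν * 2⁻¹) =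
        Real.exp (-t) * (laguerreL (ν - 1) m (2 * t) / laguerreNormSq (ν - 1) m) := by
      generalize laguerreL (ν - 1) m (2 * t) = L
      field_simp
      linear_combination (-L) * hQ
    have hc' := congrArg (fun r : ℝ => (r : ℂ)) hc
    push_cast at hc'
    rw [hint, Complex.real_smul, Complex.real_smul]
    push_cast
    linear_combination (laguerreCoeff (ν - 1) m f) * hc'
  simp only [hterm]
  refine ⟨?_, ?_⟩
  · simp only [norm_mul (Real.exp (-t) : ℂ)]
    exact hs.mul_left _
  · rw [tsum_mul_left, ht, hfdef]
    have he : (Real.exp (-t) : ℂ) * (Real.exp t : ℂ) = 1 := by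
      rw [← Complex.ofReal_mul, ← Real.exp_add]
      simp
    simp only [inv_mul_cancel_left₀ (two_ne_zero' ℝ)]
    linear_combination φ t * he
end

section
/- For every real ν > 0, every m ∈ ℕ, and every real y > 0, one has ∫_0^∞ e^{−u·y} L_m^{ν−1}(u) u^{ν−1} du = (Γ(ν+m)/m!) · y^{−ν−m} · (y−1)^m, the integral being absolutely convergent. -/
open MeasureTheory

/-- `Γ(x + n) = (x)_n Γ(x)` for `x > 0`. -/
theorem Real.ascPochhammer_eval_mul_Gamma {x : ℝ} (hx : 0 < x) (n : ℕ) :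
    (ascPochhammer ℝ n).eval x * Real.Gamma x = Real.Gamma (x + n) := by
  induction n with
  | zero => simp
  | succ n ih =>
    rw [ascPochhammer_succ_eval, mul_right_comm, ih, Nat.cast_succ, ← add_assoc,
      Real.Gamma_add_one (by positivity), mul_comm]

theorem laguerreL_integrand_eq_sum (ν : ℝ) (m : ℕ) (y : ℝ) {u : ℝ} (hu : 0 < u) :
    Real.exp (-u * y) * laguerreL (ν - 1) m u * u ^ (ν - 1) =
      ∑ k ∈ Finset.range (m + 1), ((-1 : ℝ) ^ k / (Nat.factorial k)) *
        ((ascPochhammer ℝ (m - k)).eval (ν + (k : ℝ)) / (Nat.factorial (m - k))) *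
          (u ^ (ν + k - 1) * Real.exp (-(y * u))) := by
  rw [laguerreL, Finset.mul_sum, Finset.sum_mul]
  refine Finset.sum_congr rfl fun k _ => ?_
  rw [show ν + k - 1 = (ν - 1) + (k : ℝ) by ring, Real.rpow_add hu, Real.rpow_natCast,
    show ν - 1 + (k : ℝ) + 1 = ν + k by ring, show -u * y = -(y * u) by ring]
  ring

theorem integrableOn_rpow_mul_exp_neg_mul_Ioi {a y : ℝ} (ha : 0 < a) (hy : 0 < y) :
    IntegrableOn (fun u : ℝ => u ^ (a - 1) * Real.exp (-(y * u))) (Set.Ioi 0) := by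
  simpa using
    integrableOn_rpow_mul_exp_neg_mul_rpow (s := a - 1) (by linarith) one_pos hy

/-- Laplace transform of the Laguerre polynomial (rank-one case):
`∫_0^∞ e^{-uy} L_m^{ν-1}(u) u^{ν-1} du = (Γ(ν+m)/m!) y^{-ν-m} (y-1)^m` for `y > 0`. -/
theorem laplace_transform_laguerre_polynomial (ν : ℝ) (hν : 0 < ν) (m : ℕ)
    (y : ℝ) (hy : 0 < y) :
    IntegrableOn (fun u : ℝ =>
      Real.exp (-u * y) * laguerreL (ν - 1) m u * u ^ (ν - 1)) (Set.Ioi 0) ∧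
    (∫ u in Set.Ioi (0 : ℝ), Real.exp (-u * y) * laguerreL (ν - 1) m u * u ^ (ν - 1)
      = (Real.Gamma (ν + m) / (Nat.factorial m : ℝ)) * y ^ (-ν - (m : ℝ)) * (y - 1) ^ m) := by
  have hpos (k : ℕ) : 0 < ν + k := by positivity
  have hcongr := fun (u : ℝ) (hu : u ∈ Set.Ioi (0 : ℝ)) => laguerreL_integrand_eq_sum ν m y hu
  have hint (k : ℕ) (c : ℝ) := (integrableOn_rpow_mul_exp_neg_mul_Ioi (hpos k) hy).const_mul c
  refine ⟨(integrableOn_congr_fun hcongr measurableSet_Ioi).mpr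
    (integrable_finsetSum _ fun k _ => hint k _), ?_⟩
  rw [setIntegral_congr_fun measurableSet_Ioi hcongr,
    integral_finsetSum _ fun k _ => hint k _, show y - 1 = -1 + y by ring, add_pow,
    Finset.mul_sum]
  refine Finset.sum_congr rfl fun k hk => ?_
  have hkm : k ≤ m := Nat.lt_succ_iff.mp (Finset.mem_range.mp hk)
  have hΓ := Real.ascPochhammer_eval_mul_Gamma (hpos k) (m - k)
  rw [show ν + (k : ℝ) + ((m - k : ℕ) : ℝ) = ν + m by push_cast [Nat.cast_sub hkm]; ring] at hΓ
  have hpow : (1 / y) ^ (ν + k) = y ^ (-ν - (m : ℝ)) * y ^ (m - k) := by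
    rw [one_div, Real.inv_rpow hy.le, ← Real.rpow_neg hy.le, ← Real.rpow_natCast y (m - k),
      ← Real.rpow_add hy, Nat.cast_sub hkm]
    ring_nf
  rw [integral_const_mul, Real.integral_rpow_mul_exp_neg_mul_Ioi (hpos k) hy, hpow, ← hΓ,
    Nat.cast_choose ℝ hkm]
  field_simp
end

section
/- For every real ν > 0, every m ∈ ℕ, and every complex number z with Im z > 0, one has (2/Γ(ν)) · ∫_0^∞ e^{izu} · m! · e^{−u} L_m^{ν−1}(2u) · (2u)^{ν−1} du = (ν)_m · ((z+i)/(2i))^{−ν} · ((z−i)/(z+i))^m, the integral being absolutely convergent and ((z+i)/(2i))^{−ν} = exp(−ν·Log((z+i)/(2i))) with Log the principal branch of the complex logarithm. -/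
open MeasureTheory

/-- Absolute convergence of `∫_0^∞ t^{s-1} e^{-wt} dt` for `s > 0` and `Re w > 0`. -/
lemma integrableOn_rpow_mul_cexp_neg_mul {s : ℝ} (hs : 0 < s) {w : ℂ} (hw : 0 < w.re) :
    IntegrableOn (fun t : ℝ => ((t ^ (s - 1) : ℝ) : ℂ) * Complex.exp (-(w * t))) (Set.Ioi 0) := by
  refine Integrable.mono' (integrableOn_rpow_mul_exp_neg_mul_rpow (s := s - 1) (p := 1) (b := w.re)
    (by linarith) one_pos hw) (by fun_prop) ?_
  filter_upwards [ae_restrict_mem measurableSet_Ioi] with t ht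
  rw [Set.mem_Ioi] at ht
  simp [Complex.norm_exp, abs_of_nonneg (Real.rpow_nonneg ht.le _)]

lemma hasDerivAt_integral_rpow_mul_cexp_neg_mul {s : ℝ} (hs : 0 < s) {w : ℂ} (hw : 0 < w.re) :
    HasDerivAt
      (fun w : ℂ => ∫ t in Set.Ioi (0 : ℝ), ((t ^ (s - 1) : ℝ) : ℂ) * Complex.exp (-(w * t)))
      (∫ t in Set.Ioi (0 : ℝ), ((t ^ (s - 1) : ℝ) : ℂ) * (Complex.exp (-(w * t)) * -t)) w := by
  have hU : {v : ℂ | w.re / 2 < v.re} ∈ nhds w :=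
    (Complex.isOpen_re_gt _).mem_nhds (half_lt_self hw)
  refine (hasDerivAt_integral_of_dominated_loc_of_deriv_le (μ := volume.restrict (Set.Ioi 0))
    (bound := fun t : ℝ => t ^ s * Real.exp (-(w.re / 2) * t ^ (1 : ℝ)))
    (F := fun (v : ℂ) (t : ℝ) => ((t ^ (s - 1) : ℝ) : ℂ) * Complex.exp (-(v * t)))
    (F' := fun (v : ℂ) (t : ℝ) => ((t ^ (s - 1) : ℝ) : ℂ) * (Complex.exp (-(v * t)) * -t)) hU
    (Filter.Eventually.of_forall fun v => by fun_prop)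
    (integrableOn_rpow_mul_cexp_neg_mul hs hw) (by fun_prop) ?_
    (integrableOn_rpow_mul_exp_neg_mul_rpow (by linarith) one_pos (by linarith)) ?_).2
  · filter_upwards [ae_restrict_mem measurableSet_Ioi] with t ht v hv
    rw [Set.mem_Ioi] at ht
    replace hv : w.re / 2 < v.re := hv
    have hts : t ^ s = t ^ (s - 1) * t := by
      rw [← Real.rpow_add_one ht.ne', sub_add_cancel]
    simp only [norm_mul, Complex.norm_real, Complex.norm_exp, norm_neg, Real.norm_eq_abs,
      abs_of_nonneg (Real.rpow_nonneg ht.le _), abs_of_pos ht, Complex.neg_re, Complex.mul_re,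
      Complex.ofReal_re, Complex.ofReal_im, mul_zero, sub_zero, Real.rpow_one]
    rw [hts, mul_assoc, mul_comm t]
    gcongr
    nlinarith
  · refine Filter.Eventually.of_forall fun t v _ => ?_
    have h : HasDerivAt (fun v : ℂ => -(v * t)) (-(t : ℂ)) v := by
      simpa using (hasDerivAt_mul_const (x := v) (t : ℂ)).fun_neg
    exact h.cexp.const_mul _

/-- The Gamma integral `∫_0^∞ t^{s-1} e^{-wt} dt = Γ(s) w^{-s}` for `s > 0` and `Re w > 0`. -/
lemma integral_rpow_mul_cexp_neg_mul {s : ℝ} (hs : 0 < s) {w : ℂ} (hw : 0 < w.re) :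
    ∫ t in Set.Ioi (0 : ℝ), ((t ^ (s - 1) : ℝ) : ℂ) * Complex.exp (-(w * t)) =
      (Real.Gamma s : ℂ) * Complex.exp (-(s : ℂ) * Complex.log w) := by
  have hU : IsOpen {v : ℂ | 0 < v.re} := Complex.isOpen_re_gt 0
  refine AnalyticOnNhd.eqOn_of_preconnected_of_frequently_eq (U := {v : ℂ | 0 < v.re}) (z₀ := 1)
    (f := fun w : ℂ => ∫ t in Set.Ioi (0 : ℝ), ((t ^ (s - 1) : ℝ) : ℂ) * Complex.exp (-(w * t)))
    (g := fun w => (Real.Gamma s : ℂ) * Complex.exp (-(s : ℂ) * Complex.log w))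
    (DifferentiableOn.analyticOnNhd (fun v hv => (hasDerivAt_integral_rpow_mul_cexp_neg_mul hs
      hv).differentiableAt.differentiableWithinAt) hU)
    (DifferentiableOn.analyticOnNhd (fun v hv => ?_) hU)
    (convex_halfSpace_re_gt 0).isPreconnected (by simp) ?_ hw
  · exact (((Complex.differentiableAt_log (Or.inl hv)).const_mul _).cexp.const_mul
      _).differentiableWithinAt
  · have hlim : Filter.Tendsto (fun r : ℝ => (r : ℂ)) (nhdsWithin 1 (Set.Ioi 1))
        (nhdsWithin 1 {1}ᶜ) := by
      refine tendsto_nhdsWithin_iff.2 ⟨?_, ?_⟩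
      · simpa using (Complex.continuous_ofReal.tendsto (1 : ℝ)).mono_left nhdsWithin_le_nhds
      · filter_upwards [self_mem_nhdsWithin] with r hr
        simpa using (ne_of_gt hr : r ≠ 1)
    refine hlim.frequently (Filter.Eventually.frequently ?_)
    filter_upwards [self_mem_nhdsWithin] with r (hr : 1 < r)
    have hr0 : 0 < r := one_pos.trans hr
    have h := congrArg (fun x : ℝ => (x : ℂ)) (Real.integral_rpow_mul_exp_neg_mul_Ioi hs hr0)
    simp only [← integral_complex_ofReal, Complex.ofReal_mul, Complex.ofReal_exp,
      Complex.ofReal_neg] at h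
    rw [h, mul_comm, ← Complex.ofReal_log hr0.le, one_div, Real.inv_rpow hr0.le,
      ← Real.rpow_neg hr0.le, Real.rpow_def_of_pos hr0]
    push_cast
    ring_nf

lemma Gamma_add_natCast_eq_ascPochhammer_eval_mul {s : ℝ} (hs : 0 < s) (k : ℕ) :
    Real.Gamma (s + k) = (ascPochhammer ℝ k).eval s * Real.Gamma s := by
  induction k with
  | zero => simp
  | succ k ih =>
    rw [Nat.cast_succ, ← add_assoc, Real.Gamma_add_one (by positivity), ih,
      ascPochhammer_succ_eval]
    ring

/-- The Gamma function turns Laguerre coefficients into signed binomial coefficients. -/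
lemma laguerre_coeff_mul_Gamma {ν : ℝ} (hν : 0 < ν) {m k : ℕ} (hk : k ≤ m) :
    (Nat.factorial m : ℝ) * ((-1) ^ k / Nat.factorial k *
      ((ascPochhammer ℝ (m - k)).eval (ν - 1 + k + 1) / Nat.factorial (m - k))) *
        Real.Gamma (ν + k) =
      (ascPochhammer ℝ m).eval ν * Real.Gamma ν * ((-1) ^ k * m.choose k) := by
  have hP : (ascPochhammer ℝ m).eval ν =
      (ascPochhammer ℝ k).eval ν * (ascPochhammer ℝ (m - k)).eval (ν + k) := by
    conv_lhs => rw [← Nat.add_sub_cancel' hk, ← ascPochhammer_mul]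
    simp
  rw [Gamma_add_natCast_eq_ascPochhammer_eval_mul hν, hP, Nat.cast_choose ℝ hk,
    show ν - 1 + k + 1 = ν + k by ring]
  field_simp

/-- Rank-one case of `L_ν ℓ_m^ν = (ν)_m Ψ_m^ν`: for `Im z > 0`,
`(2/Γ(ν)) ∫_0^∞ e^{izu} m! e^{-u} L_m^{ν-1}(2u) (2u)^{ν-1} du
  = (ν)_m ((z+i)/(2i))^{-ν} ((z-i)/(z+i))^m`. -/
theorem laplace_transform_laguerre_function (ν : ℝ) (hν : 0 < ν) (m : ℕ)
    (z : ℂ) (hz : 0 < z.im) :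
    IntegrableOn (fun u : ℝ =>
      Complex.exp (Complex.I * z * (u : ℂ)) *
        (((Nat.factorial m : ℝ) * Real.exp (-u) * laguerreL (ν - 1) m (2 * u) *
          (2 * u) ^ (ν - 1) : ℝ) : ℂ)) (Set.Ioi 0) ∧
    ((((2 / Real.Gamma ν : ℝ)) : ℂ) *
      ∫ u in Set.Ioi (0 : ℝ),
        Complex.exp (Complex.I * z * (u : ℂ)) *
          (((Nat.factorial m : ℝ) * Real.exp (-u) * laguerreL (ν - 1) m (2 * u) *
            (2 * u) ^ (ν - 1) : ℝ) : ℂ)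
      = (((ascPochhammer ℝ m).eval ν : ℝ) : ℂ) *
        Complex.exp (-(ν : ℂ) * Complex.log ((z + Complex.I) / (2 * Complex.I))) *
        ((z - Complex.I) / (z + Complex.I)) ^ m) := by
  set w : ℂ := (z + Complex.I) / (2 * Complex.I) with hw_def
  have hw_eq : w = (1 - Complex.I * z) / 2 := by
    rw [hw_def]
    field_simp
    linear_combination z * Complex.I_sq
  have hw : 0 < w.re := by
    have : w.re = (1 + z.im) / 2 := by simp [hw_eq]
    rw [this]
    linarith
  have hw0 : w ≠ 0 := fun h => by simp [h] at hw
  have hs (k : ℕ) : 0 < ν + k := by positivity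
  let c (k : ℕ) : ℝ := Nat.factorial m * ((-1) ^ k / Nat.factorial k *
    ((ascPochhammer ℝ (m - k)).eval (ν - 1 + k + 1) / Nat.factorial (m - k)))
  let G (t : ℝ) : ℂ := ∑ k ∈ Finset.range (m + 1),
    (c k : ℂ) * (((t ^ (ν + k - 1) : ℝ) : ℂ) * Complex.exp (-(w * t)))
  have hG_int (k : ℕ) : IntegrableOn (fun t : ℝ =>
      (c k : ℂ) * (((t ^ (ν + k - 1) : ℝ) : ℂ) * Complex.exp (-(w * t)))) (Set.Ioi 0) :=
    (integrableOn_rpow_mul_cexp_neg_mul (hs k) hw).const_mul _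
  have hG : Set.EqOn (fun u : ℝ => G (2 * u)) (fun u : ℝ => Complex.exp (Complex.I * z * (u : ℂ)) *
      (((Nat.factorial m : ℝ) * Real.exp (-u) * laguerreL (ν - 1) m (2 * u) *
        (2 * u) ^ (ν - 1) : ℝ) : ℂ)) (Set.Ioi 0) := by
    intro u (hu : 0 < u)
    have hexp : Complex.exp (-(w * ((2 * u : ℝ) : ℂ))) =
        Complex.exp (Complex.I * z * u) * (Real.exp (-u) : ℂ) := by
      rw [Complex.ofReal_exp, ← Complex.exp_add, hw_eq]
      push_cast
      ring_nf
    simp only [G, laguerreL, hexp, Finset.mul_sum, Finset.sum_mul, Complex.ofReal_sum]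
    refine Finset.sum_congr rfl fun k _ => ?_
    rw [show ν + k - 1 = ν - 1 + k by ring, Real.rpow_add_natCast (by positivity)]
    simp only [c, Complex.ofReal_mul]
    ring
  constructor
  · refine IntegrableOn.congr_fun ?_ hG measurableSet_Ioi
    rw [integrableOn_Ioi_comp_mul_left_iff G 0 two_pos, mul_zero]
    exact integrable_finsetSum _ fun k _ => hG_int k
  · rw [← setIntegral_congr_fun measurableSet_Ioi hG, integral_comp_mul_left_Ioi G 0 two_pos,
      mul_zero, integral_finsetSum _ fun k _ => hG_int k]
    have hratio : (z - Complex.I) / (z + Complex.I) = -w⁻¹ + 1 := by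
      have hz0 : z + Complex.I ≠ 0 := fun h => hw0 (by rw [hw_def, h, zero_div])
      rw [hw_def, inv_div]
      field_simp
      ring
    have hterm : ∀ k ∈ Finset.range (m + 1),
        ∫ t in Set.Ioi (0 : ℝ), (c k : ℂ) *
          (((t ^ (ν + k - 1) : ℝ) : ℂ) * Complex.exp (-(w * t))) =
        (Real.Gamma ν : ℂ) * ((((ascPochhammer ℝ m).eval ν : ℝ) : ℂ) *
          Complex.exp (-(ν : ℂ) * Complex.log w) * ((-w⁻¹) ^ k * m.choose k)) := by
      intro k hk
      have hexp : Complex.exp (-((ν + k : ℝ) : ℂ) * Complex.log w) =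
          Complex.exp (-(ν : ℂ) * Complex.log w) * w⁻¹ ^ k := by
        rw [← Complex.exp_log (inv_ne_zero hw0), ← Complex.exp_nat_mul, ← Complex.exp_add,
          Complex.log_inv _ fun h => ?_]
        · push_cast
          ring_nf
        · exact absurd (Complex.arg_eq_pi_iff.1 h).1 (by linarith)
      have hcoeff := congrArg (fun x : ℝ => (x : ℂ))
        (laguerre_coeff_mul_Gamma hν (Nat.lt_succ_iff.1 (Finset.mem_range.1 hk)))
      rw [integral_const_mul, integral_rpow_mul_cexp_neg_mul (hs k) hw, hexp, ← mul_assoc,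
        ← Complex.ofReal_mul, hcoeff, neg_pow w⁻¹]
      push_cast
      ring
    have hΓ : (Real.Gamma ν : ℂ) ≠ 0 := Complex.ofReal_ne_zero.2 (Real.Gamma_pos_of_pos hν).ne'
    rw [Finset.sum_congr rfl hterm, ← Finset.mul_sum, ← Finset.mul_sum, hratio, add_pow]
    simp only [one_pow, mul_one, Complex.real_smul]
    push_cast
    field_simp
end

section
/- For every real ν > 0, every m ∈ ℕ, and every complex number z, one has (2/Γ(ν)) · e^{−z/2} · ∫_0^∞ (∑_{k=0}^∞ (z·x)^k/(k!·(ν)_k)) · e^{−2x} · m! · L_m^{ν−1}(2x) · (2x)^{ν−1} dx = (−z/2)^m, the integral being absolutely convergent. -/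
open MeasureTheory

/-- The Chu–Vandermonde identity for ascending Pochhammer symbols. -/
theorem sum_choose_mul_ascPochhammer {R : Type*} [CommRing R] (m : ℕ) (a b : R) :
    ∑ j ∈ Finset.range (m + 1), (-1 : R) ^ j * (m.choose j : R) *
      ((ascPochhammer R j).eval a * (ascPochhammer R (m - j)).eval (b + j)) =
      (ascPochhammer R m).eval (b - a) := by
  induction m generalizing a b with
  | zero => simp
  | succ m ih =>
    have h_left : ∀ (n : ℕ) (x : R),
        (ascPochhammer R (n + 1)).eval x = x * (ascPochhammer R n).eval (x + 1) := by
      intro n x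
      simp [ascPochhammer_succ_left]
    have h_first : ∑ j ∈ Finset.range (m + 1), (-1 : R) ^ j * (m.choose j : R) *
        ((ascPochhammer R j).eval a * (ascPochhammer R (m + 1 - j)).eval (b + j)) =
        (b + m) * (ascPochhammer R m).eval (b - a) := by
      rw [← ih a b, Finset.mul_sum]
      refine Finset.sum_congr rfl fun j hj => ?_
      have hjm : j ≤ m := Nat.lt_succ_iff.mp (Finset.mem_range.mp hj)
      rw [Nat.succ_sub hjm, ascPochhammer_succ_eval, Nat.cast_sub hjm]
      ring
    have h_second : ∑ j ∈ Finset.range (m + 1), (-1 : R) ^ (j + 1) * (m.choose j : R) *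
        ((ascPochhammer R (j + 1)).eval a *
          (ascPochhammer R (m - j)).eval (b + (j + 1 : ℕ))) =
        -a * (ascPochhammer R m).eval (b - a) := by
      have h := ih (a + 1) (b + 1)
      rw [add_sub_add_right_eq_sub] at h
      rw [← h, Finset.mul_sum]
      refine Finset.sum_congr rfl fun j _ => ?_
      rw [h_left, show b + ((j + 1 : ℕ) : R) = b + 1 + j by push_cast; ring]
      ring
    rw [ascPochhammer_succ_eval, Finset.sum_range_succ']
    rw [Finset.sum_range_succ'] at h_first
    have h_split : ∑ j ∈ Finset.range (m + 1), (-1 : R) ^ (j + 1) * ((m + 1).choose (j + 1) : R) *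
        ((ascPochhammer R (j + 1)).eval a *
          (ascPochhammer R (m + 1 - (j + 1))).eval (b + (j + 1 : ℕ))) =
        ∑ j ∈ Finset.range (m + 1), (-1 : R) ^ (j + 1) * (m.choose j : R) *
          ((ascPochhammer R (j + 1)).eval a *
            (ascPochhammer R (m - j)).eval (b + (j + 1 : ℕ))) +
        ∑ j ∈ Finset.range (m + 1), (-1 : R) ^ (j + 1) * (m.choose (j + 1) : R) *
          ((ascPochhammer R (j + 1)).eval a *
            (ascPochhammer R (m - j)).eval (b + (j + 1 : ℕ))) := by
      rw [← Finset.sum_add_distrib]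
      refine Finset.sum_congr rfl fun j _ => ?_
      rw [Nat.choose_succ_succ', Nat.add_sub_add_right, Nat.cast_add]
      ring
    have h_top : ∑ j ∈ Finset.range (m + 1), (-1 : R) ^ (j + 1) * (m.choose (j + 1) : R) *
        ((ascPochhammer R (j + 1)).eval a *
          (ascPochhammer R (m - j)).eval (b + (j + 1 : ℕ))) =
        ∑ j ∈ Finset.range m, (-1 : R) ^ (j + 1) * (m.choose (j + 1) : R) *
        ((ascPochhammer R (j + 1)).eval a *
          (ascPochhammer R (m - j)).eval (b + (j + 1 : ℕ))) := by
      rw [Finset.sum_range_succ]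
      simp
    rw [h_split, h_second, h_top]
    simp only [Nat.add_sub_add_right, Nat.choose_zero_right] at h_first ⊢
    linear_combination h_first

theorem Real.Gamma_add_nat_eq_ascPochhammer {s : ℝ} (hs : 0 < s) (n : ℕ) :
    Real.Gamma (s + n) = (ascPochhammer ℝ n).eval s * Real.Gamma s := by
  induction n with
  | zero => simp
  | succ n ih =>
    rw [Nat.cast_succ, ← add_assoc, Real.Gamma_add_one (by positivity), ih,
      ascPochhammer_succ_eval]
    ring

theorem integrable_tsum_of_summable_integral_norm {α ι : Type*} [MeasurableSpace α]
    {μ : Measure α} [Countable ι] {F : ι → α → ℂ} (hF : ∀ i, Integrable (F i) μ)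
    (hF' : Summable fun i => ∫ a, ‖F i a‖ ∂μ) : Integrable (fun a => ∑' i, F i a) μ := by
  refine ⟨(AEMeasurable.tsum fun i => (hF i).aemeasurable).aestronglyMeasurable, ?_⟩
  calc ∫⁻ a, ‖∑' i, F i a‖ₑ ∂μ
      ≤ ∫⁻ a, ∑' i, ‖F i a‖ₑ ∂μ := lintegral_mono fun a => enorm_tsum_le_tsum_enorm
    _ = ∑' i, ∫⁻ a, ‖F i a‖ₑ ∂μ := lintegral_tsum fun i => (hF i).1.enorm
    _ = ∑' i, ENNReal.ofReal (∫ a, ‖F i a‖ ∂μ) := by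
      simp_rw [ofReal_integral_norm_eq_lintegral_enorm (hF _)]
    _ < ⊤ := by
      rw [← ENNReal.ofReal_tsum_of_nonneg (fun i => by positivity) hF']
      exact ENNReal.ofReal_lt_top

/-- Termwise integration of a power series against a nonnegative weight on `(0, ∞)`. -/
theorem integrableOn_and_hasSum_integral_powerSeries_mul {c : ℕ → ℂ} {w : ℝ → ℝ} {M : ℕ → ℝ}
    (hw : ∀ x, 0 < x → 0 ≤ w x) (hwi : ∀ k : ℕ, IntegrableOn (fun x => x ^ k * w x) (Set.Ioi 0))
    (hM : ∀ k : ℕ, ∫ x in Set.Ioi (0 : ℝ), x ^ k * w x = M k)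
    (hs : Summable fun k => ‖c k‖ * M k) :
    IntegrableOn (fun x : ℝ => (∑' k, c k * (x : ℂ) ^ k) * (w x : ℂ)) (Set.Ioi 0) ∧
      HasSum (fun k => c k * (M k : ℂ))
        (∫ x in Set.Ioi (0 : ℝ), (∑' k, c k * (x : ℂ) ^ k) * (w x : ℂ)) := by
  have h_term : ∀ k (x : ℝ), c k * (x : ℂ) ^ k * (w x : ℂ) = c k * ((x ^ k * w x : ℝ) : ℂ) := by
    intro k x
    push_cast
    ring
  have h_int : ∀ k, IntegrableOn (fun x : ℝ => c k * (x : ℂ) ^ k * (w x : ℂ)) (Set.Ioi 0) := by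
    intro k
    simp_rw [h_term]
    exact (hwi k).ofReal.const_mul (c k)
  have h_norm : ∀ k, ∫ x in Set.Ioi (0 : ℝ), ‖c k * (x : ℂ) ^ k * (w x : ℂ)‖ = ‖c k‖ * M k := by
    intro k
    rw [← hM k, ← integral_const_mul]
    refine setIntegral_congr_fun measurableSet_Ioi fun x hx => ?_
    have hx' : (0 : ℝ) < x := hx
    have hwx := hw x hx'
    simp only [h_term, norm_mul, Complex.norm_real]
    rw [Real.norm_of_nonneg (by positivity), Real.norm_of_nonneg hwx]
  have h_sum : Summable fun k => ∫ x in Set.Ioi (0 : ℝ), ‖c k * (x : ℂ) ^ k * (w x : ℂ)‖ := by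
    simpa only [h_norm] using hs
  simp_rw [← tsum_mul_right]
  refine ⟨integrable_tsum_of_summable_integral_norm h_int h_sum, ?_⟩
  have h_moment : ∀ k, ∫ x in Set.Ioi (0 : ℝ), c k * (x : ℂ) ^ k * (w x : ℂ) =
      c k * (M k : ℂ) := by
    intro k
    simp_rw [h_term]
    rw [integral_const_mul, integral_complex_ofReal, hM]
  simpa only [h_moment] using hasSum_integral_of_summable_integral_norm h_int h_sum

theorem integrableOn_pow_mul_exp_mul_rpow {s : ℝ} (hs : 0 < s) (k : ℕ) :
    IntegrableOn (fun x : ℝ => x ^ k * (Real.exp (-(2 * x)) * (2 * x) ^ (s - 1)))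
      (Set.Ioi 0) := by
  have h := (integrableOn_rpow_mul_exp_neg_mul_rpow (p := 1) (s := s + k - 1) (b := 2)
    (by have : (0 : ℝ) ≤ k := k.cast_nonneg
        linarith) one_pos two_pos).const_mul ((2 : ℝ) ^ (s - 1))
  refine IntegrableOn.congr_fun h (fun x hx => ?_) measurableSet_Ioi
  have hx' : (0 : ℝ) < x := hx
  simp only [Real.rpow_one]
  rw [Real.mul_rpow two_pos.le hx'.le, show s + k - 1 = (s - 1) + (k : ℝ) by ring,
    Real.rpow_add_natCast hx'.ne', neg_mul]
  ring

theorem integral_pow_mul_exp_mul_rpow {s : ℝ} (hs : 0 < s) (k : ℕ) :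
    ∫ x in Set.Ioi (0 : ℝ), x ^ k * (Real.exp (-(2 * x)) * (2 * x) ^ (s - 1)) =
      (1 / 2) ^ (k + 1) * Real.Gamma (s + k) := by
  have h := Real.integral_rpow_mul_exp_neg_mul_Ioi (a := s + k) (r := 2) (by positivity) two_pos
  have h_two : (2 : ℝ) ^ (s - 1) * (1 / 2) ^ (s + k) = (1 / 2) ^ (k + 1) := by
    rw [one_div, Real.inv_rpow two_pos.le, ← Real.rpow_neg two_pos.le, ← Real.rpow_add two_pos,
      inv_pow, ← Real.rpow_natCast, ← Real.rpow_neg two_pos.le]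
    congr 1
    push_cast
    ring
  rw [← h_two, mul_assoc, ← h, ← integral_const_mul]
  refine setIntegral_congr_fun measurableSet_Ioi fun x hx => ?_
  have hx' : (0 : ℝ) < x := hx
  rw [Real.mul_rpow two_pos.le hx'.le, show s + k - 1 = (s - 1) + (k : ℝ) by ring,
    Real.rpow_add_natCast hx'.ne']
  ring

theorem summable_pow_div_mul_Gamma {ν : ℝ} (hν : 0 < ν) (t : ℝ) (ht : 0 ≤ t) (j : ℕ) :
    Summable fun k : ℕ => t ^ k / ((k.factorial : ℝ) * (ascPochhammer ℝ k).eval ν) *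
      ((1 / 2) ^ (k + 1) * Real.Gamma (ν + j + k)) := by
  refine summable_of_ratio_norm_eventually_le (r := 1 / 2) (by norm_num) ?_
  obtain ⟨N, hN⟩ := exists_nat_ge (t * (1 + j / ν))
  filter_upwards [Filter.eventually_ge_atTop N] with k hk
  have hp := ascPochhammer_pos k ν hν
  have hG : 0 < Real.Gamma (ν + j + k) := Real.Gamma_pos_of_pos (by positivity)
  have h_ratio : t * (ν + j + k) / ((k + 1) * (ν + k)) ≤ 1 := by
    rw [div_le_one (by positivity)]
    have h1 : t * (1 + j / ν) ≤ k + 1 := by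
      have : (N : ℝ) ≤ k := by exact_mod_cast hk
      linarith
    have h2 : ν + j + k ≤ (1 + j / ν) * (ν + k) := by
      have : (1 + j / ν) * (ν + k) = ν + j + k + j / ν * k := by
        field_simp
        ring
      rw [this]
      have : 0 ≤ j / ν * k := by positivity
      linarith
    calc t * (ν + j + k) ≤ t * ((1 + j / ν) * (ν + k)) := by gcongr
      _ = t * (1 + j / ν) * (ν + k) := by ring
      _ ≤ (k + 1) * (ν + k) := by gcongr
  have h_succ : t ^ (k + 1) / (((k + 1).factorial : ℝ) * (ascPochhammer ℝ (k + 1)).eval ν) *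
      ((1 / 2) ^ (k + 1 + 1) * Real.Gamma (ν + j + (k + 1 : ℕ))) =
      1 / 2 * (t * (ν + j + k) / ((k + 1) * (ν + k))) *
        (t ^ k / ((k.factorial : ℝ) * (ascPochhammer ℝ k).eval ν) *
          ((1 / 2) ^ (k + 1) * Real.Gamma (ν + j + k))) := by
    rw [Nat.cast_succ, ← add_assoc, Real.Gamma_add_one (by positivity),
      ascPochhammer_succ_eval, Nat.factorial_succ]
    push_cast
    field_simp
    ring
  rw [h_succ, Real.norm_of_nonneg (by positivity), Real.norm_of_nonneg (by positivity)]
  gcongr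
  linarith

theorem hasSum_pow_div_factorial_mul_descFactorial (w : ℂ) (m : ℕ) :
    HasSum (fun k : ℕ => w ^ k / (k.factorial : ℂ) * (k.descFactorial m : ℂ))
      (w ^ m * Complex.exp w) := by
  rw [← hasSum_nat_add_iff' m, Finset.sum_eq_zero, sub_zero]
  · have h := (NormedSpace.expSeries_div_hasSum_exp w).mul_left (w ^ m)
    rw [← Complex.exp_eq_exp_ℂ] at h
    refine h.congr_fun fun k => ?_
    have hk : ((k + m).factorial : ℂ) = k.factorial * (k + m).descFactorial m := by
      have := Nat.factorial_mul_descFactorial (Nat.le_add_left m k)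
      rw [Nat.add_sub_cancel] at this
      exact_mod_cast this.symm
    have hd : ((k + m).descFactorial m : ℂ) ≠ 0 := by
      have := Nat.descFactorial_eq_zero_iff_lt.not.mpr (Nat.le_add_left m k).not_gt
      exact_mod_cast this
    have hf : (k.factorial : ℂ) ≠ 0 := by exact_mod_cast k.factorial_ne_zero
    rw [hk]
    field_simp
    ring
  · intro k hk
    rw [Nat.descFactorial_of_lt (Finset.mem_range.mp hk)]
    simp

/-- The moments of the Laguerre functions against the gamma weight. -/
theorem sum_laguerreL_coeff_mul_Gamma {ν : ℝ} (hν : 0 < ν) (m k : ℕ) :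
    ∑ j ∈ Finset.range (m + 1), (m.factorial : ℝ) * (((-1 : ℝ) ^ j / j.factorial) *
      ((ascPochhammer ℝ (m - j)).eval (ν - 1 + (j : ℝ) + 1) / (m - j).factorial)) *
        Real.Gamma (ν + j + k) =
      (-1) ^ m * k.descFactorial m * ((ascPochhammer ℝ k).eval ν * Real.Gamma ν) := by
  have h := sum_choose_mul_ascPochhammer m (ν + k) ν
  rw [show ν - (ν + k) = -(k : ℝ) by ring, ascPochhammer_eval_neg_eq_descPochhammer,
    descPochhammer_eval_eq_descFactorial] at h
  rw [← h, Finset.sum_mul]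
  refine Finset.sum_congr rfl fun j hj => ?_
  have hjm : j ≤ m := Nat.lt_succ_iff.mp (Finset.mem_range.mp hj)
  rw [show ν + j + k = ν + k + j by ring, Real.Gamma_add_nat_eq_ascPochhammer (by positivity),
    Real.Gamma_add_nat_eq_ascPochhammer hν, Nat.cast_choose ℝ hjm,
    show ν - 1 + (j : ℝ) + 1 = ν + j by ring]
  field_simp

/-- Rank-one case of `B_ν ℓ_m^ν = (-1/2)^m Φ_m` for the Segal–Bargmann transform:
`(2/Γ(ν)) e^{-z/2} ∫_0^∞ I_ν(zx) e^{-2x} m! L_m^{ν-1}(2x) (2x)^{ν-1} dx = (-z/2)^m`,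
where `I_ν(w) = ∑_k w^k/(k!(ν)_k)`. -/
theorem segal_bargmann_of_laguerre_function (ν : ℝ) (hν : 0 < ν) (m : ℕ) (z : ℂ) :
    IntegrableOn (fun x : ℝ =>
      (∑' k : ℕ, (z * (x : ℂ)) ^ k /
          ((Nat.factorial k : ℂ) * (((ascPochhammer ℝ k).eval ν : ℝ) : ℂ))) *
        ((Real.exp (-(2 * x)) * (Nat.factorial m : ℝ) * laguerreL (ν - 1) m (2 * x) *
          (2 * x) ^ (ν - 1) : ℝ) : ℂ)) (Set.Ioi 0) ∧
    ((((2 / Real.Gamma ν : ℝ)) : ℂ) * Complex.exp (-z / 2) *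
      ∫ x in Set.Ioi (0 : ℝ),
        (∑' k : ℕ, (z * (x : ℂ)) ^ k /
            ((Nat.factorial k : ℂ) * (((ascPochhammer ℝ k).eval ν : ℝ) : ℂ))) *
          ((Real.exp (-(2 * x)) * (Nat.factorial m : ℝ) * laguerreL (ν - 1) m (2 * x) *
            (2 * x) ^ (ν - 1) : ℝ) : ℂ)
      = (-z / 2) ^ m) := by
  set c : ℕ → ℂ := fun k => z ^ k / ((Nat.factorial k : ℂ) *
    (((ascPochhammer ℝ k).eval ν : ℝ) : ℂ)) with hc
  set d : ℕ → ℝ := fun j => (m.factorial : ℝ) * (((-1 : ℝ) ^ j / j.factorial) *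
    ((ascPochhammer ℝ (m - j)).eval (ν - 1 + (j : ℝ) + 1) / (m - j).factorial)) with hd
  set w : ℕ → ℝ → ℝ := fun j x => Real.exp (-(2 * x)) * (2 * x) ^ (ν + j - 1) with hw
  have h_mono : ∀ j : ℕ,
      IntegrableOn (fun x : ℝ => (∑' k, c k * (x : ℂ) ^ k) * (w j x : ℂ)) (Set.Ioi 0) ∧
      HasSum (fun k : ℕ => c k * (((1 / 2) ^ (k + 1) * Real.Gamma (ν + j + k) : ℝ) : ℂ))
        (∫ x in Set.Ioi (0 : ℝ), (∑' k, c k * (x : ℂ) ^ k) * (w j x : ℂ)) := by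
    intro j
    have hs : 0 < ν + j := by positivity
    refine integrableOn_and_hasSum_integral_powerSeries_mul (fun x hx => by positivity)
      (integrableOn_pow_mul_exp_mul_rpow hs) (integral_pow_mul_exp_mul_rpow hs) ?_
    convert summable_pow_div_mul_Gamma hν ‖z‖ (norm_nonneg z) j using 3 with k
    simp only [hc, norm_div, norm_pow, norm_mul, Complex.norm_natCast, Complex.norm_real]
    rw [Real.norm_of_nonneg (ascPochhammer_pos k ν hν).le]
  have h_eq : Set.EqOn (fun x : ℝ => ∑ j ∈ Finset.range (m + 1),
        (d j : ℂ) * ((∑' k, c k * (x : ℂ) ^ k) * (w j x : ℂ)))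
      (fun x : ℝ => (∑' k : ℕ, (z * (x : ℂ)) ^ k /
          ((Nat.factorial k : ℂ) * (((ascPochhammer ℝ k).eval ν : ℝ) : ℂ))) *
        ((Real.exp (-(2 * x)) * (Nat.factorial m : ℝ) * laguerreL (ν - 1) m (2 * x) *
          (2 * x) ^ (ν - 1) : ℝ) : ℂ)) (Set.Ioi 0) := by
    intro x hx
    have hx' : (0 : ℝ) < 2 * x := mul_pos two_pos hx
    have h_weight : Real.exp (-(2 * x)) * (Nat.factorial m : ℝ) * laguerreL (ν - 1) m (2 * x) *
        (2 * x) ^ (ν - 1) = ∑ j ∈ Finset.range (m + 1), d j * w j x := by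
      simp only [laguerreL, Finset.mul_sum, Finset.sum_mul]
      refine Finset.sum_congr rfl fun j _ => ?_
      simp only [hd, hw]
      rw [show ν + j - 1 = (ν - 1) + (j : ℝ) by ring, Real.rpow_add_natCast hx'.ne']
      ring
    have h_series : ∀ k : ℕ, (z * (x : ℂ)) ^ k /
        ((Nat.factorial k : ℂ) * (((ascPochhammer ℝ k).eval ν : ℝ) : ℂ)) =
        c k * (x : ℂ) ^ k := by
      intro k
      simp only [hc, mul_pow]
      ring
    simp only [h_weight, h_series]
    push_cast
    rw [Finset.mul_sum]
    refine Finset.sum_congr rfl fun j _ => ?_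
    ring
  have h_int : ∀ j ∈ Finset.range (m + 1), IntegrableOn (fun x : ℝ =>
      (d j : ℂ) * ((∑' k, c k * (x : ℂ) ^ k) * (w j x : ℂ))) (Set.Ioi 0) :=
    fun j _ => (h_mono j).1.const_mul _
  refine ⟨IntegrableOn.congr_fun (integrable_finsetSum _ h_int) h_eq measurableSet_Ioi, ?_⟩
  rw [← setIntegral_congr_fun measurableSet_Ioi h_eq, integral_finsetSum _ h_int]
  simp_rw [integral_const_mul]
  have h_sum := hasSum_sum fun j (_ : j ∈ Finset.range (m + 1)) =>
    (h_mono j).2.mul_left (d j : ℂ)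
  have h_desc := (hasSum_pow_div_factorial_mul_descFactorial (z / 2) m).mul_left
    ((-1) ^ m * (Real.Gamma ν : ℂ) / 2)
  have h_terms : ∀ k : ℕ, ∑ j ∈ Finset.range (m + 1),
      (d j : ℂ) * (c k * (((1 / 2) ^ (k + 1) * Real.Gamma (ν + j + k) : ℝ) : ℂ)) =
      (-1) ^ m * (Real.Gamma ν : ℂ) / 2 *
        ((z / 2) ^ k / (k.factorial : ℂ) * (k.descFactorial m : ℂ)) := by
    intro k
    have h := congrArg (fun r : ℝ => (r : ℂ)) (sum_laguerreL_coeff_mul_Gamma hν m k)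
    have hp : (((ascPochhammer ℝ k).eval ν : ℝ) : ℂ) ≠ 0 := by
      exact_mod_cast (ascPochhammer_pos k ν hν).ne'
    have hf : (k.factorial : ℂ) ≠ 0 := by exact_mod_cast k.factorial_ne_zero
    calc _ = c k * (1 / 2) ^ (k + 1) *
          ((∑ j ∈ Finset.range (m + 1), d j * Real.Gamma (ν + j + k) : ℝ) : ℂ) := by
          push_cast
          rw [Finset.mul_sum]
          refine Finset.sum_congr rfl fun j _ => ?_
          ring
      _ = _ := by
          rw [h]
          simp only [hc]
          push_cast
          rw [div_pow, div_pow, one_pow, pow_succ]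
          field_simp
  simp_rw [h_terms] at h_sum
  rw [h_sum.unique h_desc]
  have hΓ : (Real.Gamma ν : ℂ) ≠ 0 := by exact_mod_cast (Real.Gamma_pos_of_pos hν).ne'
  have h_exp : Complex.exp (-z / 2) * Complex.exp (z / 2) = 1 := by
    rw [← Complex.exp_add, neg_div, neg_add_cancel, Complex.exp_zero]
  have h_pow : (-z / 2) ^ m = (-1) ^ m * (z / 2) ^ m := by
    rw [← mul_pow]
    ring
  rw [h_pow]
  push_cast
  calc _ = (Complex.exp (-z / 2) * Complex.exp (z / 2)) *
        ((Real.Gamma ν : ℂ) / (Real.Gamma ν : ℂ)) * ((-1) ^ m * (z / 2) ^ m) := by ring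
    _ = _ := by rw [h_exp, div_self hΓ, one_mul, one_mul]
end
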